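/- There exists, for every ε > 0, a constant C(ε) > 0 such that for every natural number N ≥ 2, if A ⊆ {1,…,N} contains no non-trivial three-term arithmetic progression (i.e. no triple (x, x+d, x+2d) with all three terms in A and d ≠ 0), then |A| ≤ C(ε)·N / (log N)^{3/4−ε}. -/

import Mathlib

set_option linter.unusedSectionVars false

namespace RothBohr
open Finset

section Bohr
variable {G : Type*} [AddCommGroup G] [Fintype G]

open Classical in
/-- The Bohr set with frequency set `Γ` and radius `r`. -/
noncomputable def bohr (Γ : Finset (AddChar G ℂ)) (r : ℝ) : Finset G :=
  univ.filter fun x => ∀ γ ∈ Γ, ‖γ x - 1‖ ≤ r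

lemma mem_bohr {Γ : Finset (AddChar G ℂ)} {r : ℝ} {x : G} :
    x ∈ bohr Γ r ↔ ∀ γ ∈ Γ, ‖γ x - 1‖ ≤ r := by
  simp [bohr]

lemma norm_char_add_sub_one_le (γ : AddChar G ℂ) (x y : G) :
    ‖γ (x + y) - 1‖ ≤ ‖γ x - 1‖ + ‖γ y - 1‖ := by
  have h : γ (x + y) - 1 = (γ x - 1) * γ y + (γ y - 1) := by
    rw [AddChar.map_add_eq_mul]; ring
  rw [h]
  refine (norm_add_le _ _).trans ?_
  rw [norm_mul, AddChar.norm_apply, mul_one]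

lemma norm_char_neg_sub_one (γ : AddChar G ℂ) (x : G) : ‖γ (-x) - 1‖ = ‖γ x - 1‖ := by
  have h : γ x * (γ (-x) - 1) = -(γ x - 1) := by
    rw [mul_sub, ← AddChar.map_add_eq_mul]; simp
  have := congrArg norm h
  rwa [norm_mul, AddChar.norm_apply, one_mul, norm_neg] at this

lemma norm_char_sub_char (γ : AddChar G ℂ) (x y : G) : ‖γ x - γ y‖ = ‖γ (x - y) - 1‖ := by
  have h : γ x - γ y = (γ (x - y) - 1) * γ y := by
    rw [sub_mul, ← AddChar.map_add_eq_mul]; simp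
  rw [h, norm_mul, AddChar.norm_apply, mul_one]

lemma zero_mem_bohr {Γ : Finset (AddChar G ℂ)} {r : ℝ} (hr : 0 ≤ r) : (0 : G) ∈ bohr Γ r := by
  simp [mem_bohr, hr]

lemma card_bohr_pos {Γ : Finset (AddChar G ℂ)} {r : ℝ} (hr : 0 ≤ r) : 0 < #(bohr Γ r) :=
  card_pos.2 ⟨0, zero_mem_bohr hr⟩

lemma neg_mem_bohr {Γ : Finset (AddChar G ℂ)} {r : ℝ} {x : G} (hx : x ∈ bohr Γ r) :
    -x ∈ bohr Γ r := by
  rw [mem_bohr] at *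
  intro γ hγ
  rw [norm_char_neg_sub_one]
  exact hx γ hγ

lemma bohr_mono {Γ : Finset (AddChar G ℂ)} {r s : ℝ} (h : r ≤ s) : bohr Γ r ⊆ bohr Γ s :=
  fun _ hx => mem_bohr.2 fun γ hγ => (mem_bohr.1 hx γ hγ).trans h

lemma bohr_anti {Γ Δ : Finset (AddChar G ℂ)} {r : ℝ} (h : Γ ⊆ Δ) : bohr Δ r ⊆ bohr Γ r :=
  fun _ hx => mem_bohr.2 fun γ hγ => mem_bohr.1 hx γ (h hγ)

lemma add_mem_bohr {Γ : Finset (AddChar G ℂ)} {r s t : ℝ} {x y : G} (hx : x ∈ bohr Γ r)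
    (hy : y ∈ bohr Γ s) (h : r + s ≤ t) : x + y ∈ bohr Γ t :=
  mem_bohr.2 fun γ hγ => (norm_char_add_sub_one_le γ x y).trans
    ((add_le_add (mem_bohr.1 hx γ hγ) (mem_bohr.1 hy γ hγ)).trans h)

lemma sub_mem_bohr {Γ : Finset (AddChar G ℂ)} {r s t : ℝ} {x y : G} (hx : x ∈ bohr Γ r)
    (hy : y ∈ bohr Γ s) (h : r + s ≤ t) : x - y ∈ bohr Γ t := by
  rw [sub_eq_add_neg]; exact add_mem_bohr hx (neg_mem_bohr hy) h

lemma floor_two_mul_div_mem {r a : ℝ} (hr : 0 < r) (ha : |a| ≤ 2 * r) :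
    ⌊2 * a / r⌋ ∈ Icc (-4 : ℤ) 4 := by
  rw [abs_le] at ha
  rw [mem_Icc]
  constructor
  · rw [Int.le_floor, le_div_iff₀ hr]; push_cast; linarith
  · have : 2 * a / r ≤ 4 := by rw [div_le_iff₀ hr]; linarith
    exact_mod_cast (Int.floor_le _).trans this

lemma abs_sub_le_of_floor_eq {r a b : ℝ} (hr : 0 < r) (h : ⌊2 * a / r⌋ = ⌊2 * b / r⌋) :
    |a - b| ≤ r / 2 := by
  have := Int.abs_sub_lt_one_of_floor_eq_floor h
  rw [← sub_div, abs_div, abs_of_pos hr, div_lt_one hr, ← mul_sub, abs_mul] at this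
  norm_num at this
  linarith

lemma card_bohr_two_mul_le (Γ : Finset (AddChar G ℂ)) {r : ℝ} (hr : 0 < r) :
    #(bohr Γ (2 * r)) ≤ 81 ^ #Γ * #(bohr Γ r) := by
  classical
  let φ : G → Γ → ℤ × ℤ := fun x γ =>
    (⌊2 * (γ.1 x - 1).re / r⌋, ⌊2 * (γ.1 x - 1).im / r⌋)
  let t : Finset (Γ → ℤ × ℤ) := Fintype.piFinset fun _ => Icc (-4 : ℤ) 4 ×ˢ Icc (-4 : ℤ) 4
  have ht : #t = 81 ^ #Γ := by
    simp [t, Fintype.card_piFinset]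
  have hmaps : ∀ x ∈ bohr Γ (2 * r), φ x ∈ t := by
    intro x hx
    rw [Fintype.mem_piFinset]
    intro γ
    have h := mem_bohr.1 hx γ.1 γ.2
    exact mem_product.2 ⟨floor_two_mul_div_mem hr ((Complex.abs_re_le_norm _).trans h),
      floor_two_mul_div_mem hr ((Complex.abs_im_le_norm _).trans h)⟩
  have := card_le_mul_card_image_of_maps_to hmaps #(bohr Γ r) ?_
  · rwa [ht, mul_comm #(bohr Γ r)] at this
  intro b _
  rcases (filter (fun x => φ x = b) (bohr Γ (2 * r))).eq_empty_or_nonempty with h | ⟨x₀, hx₀⟩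
  · rw [h]; simp
  refine card_le_card_of_injOn (fun x => x - x₀) ?_ (fun x _ y _ h => sub_left_injective h)
  intro x hx
  have hx' := (mem_filter.1 (mem_coe.1 hx)).2
  have hx₀' := (mem_filter.1 hx₀).2
  rw [mem_coe, mem_bohr]
  intro γ hγ
  have heq : φ x ⟨γ, hγ⟩ = φ x₀ ⟨γ, hγ⟩ := by rw [hx', hx₀']
  rw [← norm_char_sub_char]
  have h1 := abs_sub_le_of_floor_eq hr (congrArg Prod.fst heq)
  have h2 := abs_sub_le_of_floor_eq hr (congrArg Prod.snd heq)
  have h3 := Complex.norm_le_abs_re_add_abs_im (γ x - γ x₀)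
  simp only [Complex.sub_re, Complex.sub_im] at h1 h2 h3
  rw [sub_sub_sub_cancel_right] at h1 h2
  linarith

lemma bohr_two (Γ : Finset (AddChar G ℂ)) : bohr Γ 2 = univ := by
  refine eq_univ_of_forall fun x => mem_bohr.2 fun γ _ => (norm_sub_le _ _).trans ?_
  rw [AddChar.norm_apply]; norm_num

lemma card_le_card_bohr (Γ : Finset (AddChar G ℂ)) (n : ℕ) :
    Fintype.card G ≤ 81 ^ (n * #Γ) * #(bohr Γ (2 / 2 ^ n)) := by
  induction n with
  | zero => simp [bohr_two]
  | succ n ih =>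
    have h := card_bohr_two_mul_le Γ (r := 2 / 2 ^ (n + 1)) (by positivity)
    have h2 : (2 : ℝ) * (2 / 2 ^ (n + 1)) = 2 / 2 ^ n := by field_simp; ring
    rw [h2] at h
    calc _ ≤ _ := ih
      _ ≤ 81 ^ (n * #Γ) * (81 ^ #Γ * #(bohr Γ (2 / 2 ^ (n + 1)))) := Nat.mul_le_mul_left _ h
      _ = _ := by ring

/-- A radius at which a Bohr set grows only slightly when enlarged by the factor `1 + κ`. -/
def IsRegular (Γ : Finset (AddChar G ℂ)) (κ : ℝ) (q : ℕ) (r : ℝ) : Prop :=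
  (#(bohr Γ (r + κ * r)) : ℝ) ≤ (1 + 1 / q) * #(bohr Γ r)

lemma exists_isRegular (Γ : Finset (AddChar G ℂ)) {q M : ℕ} (hq : 1 ≤ q)
    (hM : 7 * q * (#Γ + 1) ≤ M) {κ : ℝ} (hκ : 2 * κ * M ≤ 1) {R : ℝ} (hR : 0 < R) (hκ0 : 0 ≤ κ) :
    ∃ r, R / 2 ≤ r ∧ r ≤ R ∧ IsRegular Γ κ q r := by
  by_contra! hcon
  have hM0 : 0 < M := lt_of_lt_of_le (by positivity) hM
  have hM0' : (0 : ℝ) < M := by exact_mod_cast hM0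
  have hq' : (1 : ℝ) ≤ q := by exact_mod_cast hq
  let ρ : ℕ → ℝ := fun j => R / 2 + j * (R / (2 * M))
  have hstep : ∀ j < M, (1 + 1 / (q : ℝ)) * #(bohr Γ (ρ j)) ≤ #(bohr Γ (ρ (j + 1))) := by
    intro j hj
    have hj' : (j : ℝ) ≤ M := by exact_mod_cast hj.le
    have h1 : ρ j ≤ R := by
      have : (j : ℝ) * (R / (2 * M)) ≤ M * (R / (2 * M)) := by gcongr
      have h2 : (M : ℝ) * (R / (2 * M)) = R / 2 := by field_simp
      simp only [ρ]; linarith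
    have h0 : R / 2 ≤ ρ j := by
      have : 0 ≤ (j : ℝ) * (R / (2 * M)) := by positivity
      simp only [ρ]; linarith
    have h3 := hcon (ρ j) h0 h1
    rw [IsRegular, not_le] at h3
    refine h3.le.trans ?_
    refine Nat.cast_le.2 (card_le_card (bohr_mono ?_))
    have h4 : κ * ρ j ≤ R / (2 * M) := by
      have : κ * ρ j ≤ κ * R := by gcongr
      refine this.trans ?_
      rw [le_div_iff₀ (by positivity)]
      calc κ * R * (2 * M) = (2 * κ * M) * R := by ring
        _ ≤ 1 * R := by gcongr
        _ = R := one_mul R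
    simp only [ρ] at h4 ⊢
    push_cast
    linarith
  have hall : ∀ j ≤ M, (1 + 1 / (q : ℝ)) ^ j * #(bohr Γ (ρ 0)) ≤ #(bohr Γ (ρ j)) := by
    intro j
    induction j with
    | zero => simp
    | succ j ih =>
      intro hj
      refine le_trans ?_ (hstep j hj)
      rw [pow_succ', mul_assoc]
      exact mul_le_mul_of_nonneg_left (ih (by omega)) (by positivity)
  have hfin := hall M le_rfl
  have hρM : ρ M = 2 * (R / 2) := by
    simp only [ρ]; field_simp; ring
  have hρ0 : ρ 0 = R / 2 := by simp [ρ]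
  rw [hρM, hρ0] at hfin
  have hdb : (#(bohr Γ (2 * (R / 2))) : ℝ) ≤ 81 ^ #Γ * #(bohr Γ (R / 2)) := by
    exact_mod_cast card_bohr_two_mul_le Γ (half_pos hR)
  have hpos : (0 : ℝ) < #(bohr Γ (R / 2)) := by exact_mod_cast card_bohr_pos (half_pos hR).le
  have h5 : (1 + 1 / (q : ℝ)) ^ M ≤ 81 ^ #Γ := le_of_mul_le_mul_right (hfin.trans hdb) hpos
  have h6 : (2 : ℝ) ≤ (1 + 1 / (q : ℝ)) ^ q := by
    have := one_add_mul_le_pow (a := 1 / (q : ℝ)) (by have : 0 ≤ 1 / (q : ℝ) := by positivity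
                                                      linarith) q
    refine le_trans (le_of_eq ?_) this
    field_simp; norm_num
  have h7 : (2 : ℝ) ^ (7 * (#Γ + 1)) ≤ (1 + 1 / (q : ℝ)) ^ M :=
    calc (2 : ℝ) ^ (7 * (#Γ + 1)) ≤ ((1 + 1 / (q : ℝ)) ^ q) ^ (7 * (#Γ + 1)) := by gcongr
      _ = (1 + 1 / (q : ℝ)) ^ (7 * q * (#Γ + 1)) := by rw [← pow_mul]; ring_nf
      _ ≤ _ := pow_le_pow_right₀ (by have : 0 ≤ 1 / (q : ℝ) := by positivity
                                     linarith) hM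
  have h8 : (81 : ℝ) ^ #Γ < 2 ^ (7 * (#Γ + 1)) :=
    calc (81 : ℝ) ^ #Γ ≤ (2 ^ 7) ^ #Γ := by gcongr; norm_num
      _ < (2 ^ 7) ^ (#Γ + 1) := pow_lt_pow_right₀ (by norm_num) (by omega)
      _ = _ := by rw [← pow_mul]
  linarith

lemma norm_sum_shift_sub_le [DecidableEq G] {E : Type*} [NormedAddCommGroup E] {B B' : Finset G}
    {δ : ℝ}
    (hB : B ⊆ B') {y : G} (hy : ∀ x ∈ B, x + y ∈ B') (hc : (#B' : ℝ) ≤ (1 + δ) * #B)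
    (f : G → E) (hf : ∀ x, ‖f x‖ ≤ 1) :
    ‖∑ x ∈ B, f (x + y) - ∑ x ∈ B, f x‖ ≤ 2 * δ * #B := by
  have key : ∀ C : Finset G, C ⊆ B' → #C = #B →
      ‖∑ x ∈ B', f x - ∑ x ∈ C, f x‖ ≤ δ * #B := by
    intro C hC hcard
    rw [← sum_sdiff hC, add_sub_cancel_right]
    refine (norm_sum_le_of_le _ (fun x _ => hf x)).trans ?_
    rw [sum_const, nsmul_eq_mul, mul_one, card_sdiff_of_subset hC,
      Nat.cast_sub (card_le_card hC), hcard]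
    linarith
  have himg : ∑ x ∈ B, f (x + y) = ∑ x ∈ B.image (· + y), f x := by
    rw [sum_image (fun x _ y _ h => add_left_injective _ h)]
  have h1 := key (B.image (· + y)) (image_subset_iff.2 hy)
    (card_image_of_injective _ (add_left_injective y))
  have h2 := key B hB rfl
  rw [himg]
  calc _ = ‖(∑ x ∈ B', f x - ∑ x ∈ B, f x) - (∑ x ∈ B', f x - ∑ x ∈ B.image (· + y), f x)‖ := by
        congr 1; abel
    _ ≤ _ := norm_sub_le _ _
    _ ≤ _ := by linarith

open Classical in
/-- The frequency set of the dilate by `2` of a Bohr set. -/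
noncomputable def dil (half : G →+ G) (Γ : Finset (AddChar G ℂ)) : Finset (AddChar G ℂ) :=
  Γ.image fun γ => γ.compAddMonoidHom half

lemma mem_bohr_dil {half : G →+ G} {Γ : Finset (AddChar G ℂ)} {r : ℝ} {y : G} :
    y ∈ bohr (dil half Γ) r ↔ half y ∈ bohr Γ r := by
  simp [mem_bohr, dil]

lemma card_dil_le {half : G →+ G} {Γ : Finset (AddChar G ℂ)} : #(dil half Γ) ≤ #Γ := by
  classical exact card_image_le

lemma half_add_self {half : G →+ G} (h : ∀ x, half x + half x = x) (x : G) :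
    half (x + x) = x := by rw [map_add, h]

lemma card_bohr_dil {half : G →+ G} (h : ∀ x, half x + half x = x) (Γ : Finset (AddChar G ℂ))
    (r : ℝ) : #(bohr (dil half Γ) r) = #(bohr Γ r) := by
  refine card_bij' (fun y _ => half y) (fun x _ => x + x) ?_ ?_ ?_ ?_
  · intro y hy; exact mem_bohr_dil.1 hy
  · intro x hx; rw [mem_bohr_dil, half_add_self h]; exact hx
  · intro y _; exact h y
  · intro x _; exact half_add_self h x

lemma bohr_dil_subset {half : G →+ G} (h : ∀ x, half x + half x = x) (Γ : Finset (AddChar G ℂ))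
    (r : ℝ) : bohr (dil half Γ) r ⊆ bohr Γ (2 * r) := by
  intro y hy
  rw [mem_bohr_dil] at hy
  rw [← h y]
  exact add_mem_bohr hy hy (by linarith)

end Bohr

section Moments

lemma mean_pow_le {ι : Type*} (U : Finset ι) (f : ι → ℝ) (m : ℕ) (hm : 1 ≤ m) :
    ((∑ i ∈ U, f i) / #U) ^ (2 * m) ≤ (∑ i ∈ U, f i ^ (2 * m)) / #U := by
  rcases U.eq_empty_or_nonempty with rfl | hU
  · have : 2 * m ≠ 0 := by omega
    simp [this]
  have hc : (0 : ℝ) < #U := by exact_mod_cast hU.card_pos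
  have := Real.pow_arith_mean_le_arith_mean_pow_of_even U (fun _ => (#U : ℝ)⁻¹) f
    (fun _ _ => by positivity) (by simp [hc.ne']) (n := 2 * m) (even_two_mul m)
  rw [← mul_sum, ← mul_sum] at this
  rw [div_eq_inv_mul, div_eq_inv_mul]
  exact this

lemma add_pow_two_mul_le (a b : ℝ) (m : ℕ) :
    (a + b) ^ (2 * m) ≤ 4 ^ m * (a ^ (2 * m) + b ^ (2 * m)) := by
  refine (Even.add_pow_le (even_two_mul m)).trans ?_
  have h0 : 0 ≤ a ^ (2 * m) + b ^ (2 * m) :=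
    add_nonneg ((even_two_mul m).pow_nonneg _) ((even_two_mul m).pow_nonneg _)
  refine mul_le_mul_of_nonneg_right ?_ h0
  calc (2 : ℝ) ^ (2 * m - 1) ≤ 2 ^ (2 * m) := pow_le_pow_right₀ (by norm_num) (by omega)
    _ = 4 ^ m := by rw [pow_mul]; norm_num

lemma pow_two_mul_le_exp (x : ℝ) (m : ℕ) :
    x ^ (2 * m) ≤ (2 * m).factorial * (Real.exp x + Real.exp (-x)) := by
  have h := Real.pow_div_factorial_le_exp |x| (abs_nonneg x) (2 * m)
  rw [(even_two_mul m).pow_abs, div_le_iff₀ (by positivity), mul_comm (Real.exp |x|)] at h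
  refine h.trans (mul_le_mul_of_nonneg_left ?_ (by positivity))
  rcases abs_cases x with ⟨h, _⟩ | ⟨h, _⟩ <;> rw [h]
  · linarith [Real.exp_pos (-x)]
  · linarith [Real.exp_pos x]

variable {ι : Type*} {A : Finset ι} {Y : ι → ℝ} {p : ℝ}

lemma sum_exp_le (hY : ∀ a ∈ A, 0 ≤ Y a ∧ Y a ≤ 1) (hp0 : 0 ≤ p) (hp1 : p ≤ 1)
    (hp : ∑ a ∈ A, Y a = #A * p) {s : ℝ} (hs : |s| ≤ 1) :
    ∑ a ∈ A, Real.exp (s * (Y a - p)) ≤ #A * Real.exp (s ^ 2 * p) := by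
  have h1 : ∀ a ∈ A, Real.exp (s * (Y a - p)) ≤
      1 + s * (Y a - p) + s ^ 2 * (Y a - 2 * p * Y a + p ^ 2) := by
    intro a ha
    obtain ⟨h0, h1⟩ := hY a ha
    have habs : |s * (Y a - p)| ≤ 1 := by
      rw [abs_mul]
      exact mul_le_one₀ hs (abs_nonneg _) (abs_le.2 ⟨by linarith, by linarith⟩)
    have := (abs_le.1 (Real.abs_exp_sub_one_sub_id_le habs)).2
    have h3 : (s * (Y a - p)) ^ 2 ≤ s ^ 2 * (Y a - 2 * p * Y a + p ^ 2) := by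
      rw [mul_pow]
      refine mul_le_mul_of_nonneg_left ?_ (sq_nonneg s)
      nlinarith
    linarith
  refine (sum_le_sum h1).trans ?_
  have h2 : ∑ a ∈ A, (1 + s * (Y a - p) + s ^ 2 * (Y a - 2 * p * Y a + p ^ 2)) =
      #A * (1 + s ^ 2 * (p - p ^ 2)) := by
    simp only [sum_add_distrib, ← mul_sum, sum_sub_distrib, sum_const, nsmul_eq_mul, hp]
    ring
  rw [h2]
  refine mul_le_mul_of_nonneg_left ?_ (by positivity)
  have h3 := Real.add_one_le_exp (s ^ 2 * p)
  nlinarith [mul_nonneg (sq_nonneg s) (sq_nonneg p)]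

lemma sum_piFinset_exp_le (hY : ∀ a ∈ A, 0 ≤ Y a ∧ Y a ≤ 1) (hp0 : 0 ≤ p) (hp1 : p ≤ 1)
    (hp : ∑ a ∈ A, Y a = #A * p) {s : ℝ} (hs : |s| ≤ 1) (k : ℕ) :
    ∑ a ∈ Fintype.piFinset (fun _ : Fin k => A), Real.exp (s * ∑ i, (Y (a i) - p)) ≤
      (#A : ℝ) ^ k * Real.exp (k * (s ^ 2 * p)) := by
  have h : ∀ a : Fin k → ι, Real.exp (s * ∑ i, (Y (a i) - p)) =
      ∏ i, Real.exp (s * (Y (a i) - p)) := by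
    intro a; rw [mul_sum, Real.exp_sum]
  simp only [h]
  rw [sum_prod_piFinset A (fun (_ : Fin k) j => Real.exp (s * (Y j - p))), prod_const,
    card_univ, Fintype.card_fin, Real.exp_nat_mul, ← mul_pow]
  exact pow_le_pow_left₀ (sum_nonneg fun _ _ => (Real.exp_pos _).le)
    (sum_exp_le hY hp0 hp1 hp hs) k

lemma sum_moment_le (hY : ∀ a ∈ A, 0 ≤ Y a ∧ Y a ≤ 1) (hp0 : 0 ≤ p) (hp1 : p ≤ 1)
    (hp : ∑ a ∈ A, Y a = #A * p) {k m : ℕ} (hm : 1 ≤ m) {α Q : ℝ} (hα : 0 < α) (hQ : 1 ≤ Q)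
    (hk : Q * m ≤ k * α) :
    ∑ a ∈ Fintype.piFinset (fun _ : Fin k => A), ((∑ i, Y (a i)) / k - p) ^ (2 * m) ≤
      (#A : ℝ) ^ k * (4 * (12 / Q) ^ m * (α ^ (2 * m) + p ^ (2 * m))) := by
  have hm' : (1 : ℝ) ≤ m := by exact_mod_cast hm
  have hk0 : (0 : ℝ) < k := by
    by_contra! h
    nlinarith
  set w := max α p with hw
  have hw0 : 0 < w := lt_max_of_lt_left hα
  have hwα : α ≤ w := le_max_left _ _
  have hwp : p ≤ w := le_max_right _ _
  set lam := Real.sqrt (m / (k * w)) with hlam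
  have hlam2 : lam ^ 2 = m / (k * w) := Real.sq_sqrt (by positivity)
  have hlam0 : 0 < lam := Real.sqrt_pos.2 (by positivity)
  have hkw : Q * m ≤ k * w := hk.trans (mul_le_mul_of_nonneg_left hwα hk0.le)
  have hlam1 : lam ≤ 1 := by
    rw [hlam, Real.sqrt_le_one, div_le_one (by positivity)]
    nlinarith
  have hexp : ∀ s : ℝ, s = lam ∨ s = -lam →
      ∑ a ∈ Fintype.piFinset (fun _ : Fin k => A), Real.exp (s * ∑ i, (Y (a i) - p)) ≤
      (#A : ℝ) ^ k * 3 ^ m := by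
    intro s hs
    have hs1 : |s| ≤ 1 := by
      rcases hs with rfl | rfl
      · rw [abs_of_pos hlam0]; exact hlam1
      · rw [abs_neg, abs_of_pos hlam0]; exact hlam1
    have hs2 : s ^ 2 = lam ^ 2 := by rcases hs with rfl | rfl <;> ring
    refine (sum_piFinset_exp_le hY hp0 hp1 hp hs1 k).trans ?_
    refine mul_le_mul_of_nonneg_left ?_ (by positivity)
    rw [hs2, hlam2]
    have h4 : (k : ℝ) * (m / (k * w) * p) ≤ m := by
      have : (k : ℝ) * (m / (k * w) * p) = m * (p / w) := by field_simp
      rw [this]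
      exact mul_le_of_le_one_right (by positivity) ((div_le_one hw0).2 hwp)
    refine (Real.exp_le_exp.2 h4).trans ?_
    rw [← mul_one (m : ℝ), Real.exp_nat_mul]
    exact pow_le_pow_left₀ (Real.exp_pos 1).le Real.exp_one_lt_three.le m
  have hpt : ∀ a : Fin k → ι, ((∑ i, Y (a i)) / k - p) ^ (2 * m) ≤
      (2 * m).factorial / ((m / (k * w)) ^ m * (k ^ 2) ^ m) *
        (Real.exp (lam * ∑ i, (Y (a i) - p)) + Real.exp (-lam * ∑ i, (Y (a i) - p))) := by
    intro a
    have h5 : (∑ i, Y (a i)) / k - p = (∑ i, (Y (a i) - p)) / k := by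
      rw [sum_sub_distrib]; simp; field_simp
    have h6 := pow_two_mul_le_exp (lam * ∑ i, (Y (a i) - p)) m
    rw [mul_pow, pow_mul lam, hlam2] at h6
    rw [← neg_mul] at h6
    rw [h5, div_pow, pow_mul (k : ℝ)]
    rw [div_mul_eq_mul_div, div_le_div_iff₀ (by positivity) (by positivity)]
    have : 0 ≤ ((k : ℝ) ^ 2) ^ m := by positivity
    nlinarith
  refine (sum_le_sum fun a _ => hpt a).trans ?_
  rw [← mul_sum, sum_add_distrib]
  have h7 := add_le_add (hexp lam (Or.inl rfl)) (hexp (-lam) (Or.inr rfl))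
  refine (mul_le_mul_of_nonneg_left h7 (by positivity)).trans ?_
  have hfac : ((2 * m).factorial : ℝ) ≤ (4 * m ^ 2) ^ m := by
    have : ((2 * m).factorial : ℝ) ≤ ((2 * m : ℕ) : ℝ) ^ (2 * m) := by
      exact_mod_cast Nat.factorial_le_pow (2 * m)
    refine this.trans (le_of_eq ?_)
    rw [pow_mul]; push_cast; ring_nf
  have hmain : ((2 * m).factorial : ℝ) / ((m / (k * w)) ^ m * (k ^ 2) ^ m) * 3 ^ m ≤
      (12 / Q) ^ m * w ^ (2 * m) := by
    calc ((2 * m).factorial : ℝ) / ((m / (k * w)) ^ m * (k ^ 2) ^ m) * 3 ^ m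
        ≤ (4 * m ^ 2) ^ m / ((m / (k * w)) ^ m * (k ^ 2) ^ m) * 3 ^ m := by gcongr
      _ = (12 * w * (m / k)) ^ m := by
          rw [← mul_pow, ← div_pow, ← mul_pow]; congr 1; field_simp; ring
      _ ≤ (12 * w * (w / Q)) ^ m := by
          refine pow_le_pow_left₀ (by positivity) (mul_le_mul_of_nonneg_left ?_ (by positivity)) m
          rw [div_le_div_iff₀ hk0 (by positivity)]; linarith
      _ = _ := by rw [pow_mul w, ← mul_pow]; congr 1; ring
  have hwpow : w ^ (2 * m) ≤ α ^ (2 * m) + p ^ (2 * m) := by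
    rcases max_choice α p with h | h
    · rw [hw, h]; linarith [pow_nonneg hp0 (2 * m)]
    · rw [hw, h]; linarith [pow_nonneg hα.le (2 * m)]
  have h8 : (12 / Q) ^ m * w ^ (2 * m) ≤ (12 / Q) ^ m * (α ^ (2 * m) + p ^ (2 * m)) :=
    mul_le_mul_of_nonneg_left hwpow (by positivity)
  have hA : (0 : ℝ) ≤ (#A : ℝ) ^ k := by positivity
  have h9 := mul_le_mul_of_nonneg_left (hmain.trans h8) hA
  have h10 : 0 ≤ (#A : ℝ) ^ k * ((12 / Q) ^ m * (α ^ (2 * m) + p ^ (2 * m))) := by positivity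
  calc _ = 2 * ((#A : ℝ) ^ k * ((2 * m).factorial / ((m / (k * w)) ^ m * (k ^ 2) ^ m) * 3 ^ m)) := by
        ring
    _ ≤ _ := by linarith

end Moments

section AlmostPeriods
variable {G : Type*} [AddCommGroup G] [Fintype G] [DecidableEq G]

/-- The real indicator function of a finite set. -/
def ind (A : Finset G) (x : G) : ℝ := if x ∈ A then 1 else 0

lemma ind_nonneg (A : Finset G) (x : G) : 0 ≤ ind A x := by unfold ind; split_ifs <;> norm_num

lemma ind_le_one (A : Finset G) (x : G) : ind A x ≤ 1 := by unfold ind; split_ifs <;> norm_num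

/-- The normalised self-convolution of the indicator function of `A`. -/
noncomputable def selfConv (A : Finset G) (z : G) : ℝ := (∑ a ∈ A, ind A (z - a)) / #A

lemma selfConv_nonneg (A : Finset G) (z : G) : 0 ≤ selfConv A z :=
  div_nonneg (sum_nonneg fun _ _ => ind_nonneg _ _) (Nat.cast_nonneg _)

lemma selfConv_le_one (A : Finset G) (z : G) : selfConv A z ≤ 1 := by
  refine div_le_one_of_le₀ ?_ (Nat.cast_nonneg _)
  refine (sum_le_sum fun a _ => ind_le_one A (z - a)).trans ?_
  simp

/-- A Croot–Sisask lemma for the self-convolution of a set. -/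
lemma exists_almostPeriods {A S B X : Finset G} (hA : A.Nonempty) (hX : X.Nonempty)
    (hAS : ∀ a ∈ A, ∀ s ∈ S, a - s ∈ B) {k m : ℕ} (hm : 1 ≤ m) {α Q : ℝ} (hα : 0 < α)
    (hQ : 1 ≤ Q) (hk : Q * m ≤ k * α) :
    ∃ T ⊆ S, (#S : ℝ) * #A ^ k ≤ 2 * (#T * #B ^ k) ∧ ∀ t ∈ T, ∀ t' ∈ T, ∀ Y ⊆ X,
      (∀ w ∈ Y, w + (t' - t) ∈ X) →
      ∑ w ∈ Y, (selfConv A (w + (t' - t)) - selfConv A w) ^ (2 * m) ≤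
        16 * (48 / Q) ^ m * ∑ w ∈ X, (α ^ (2 * m) + selfConv A w ^ (2 * m)) := by
  classical
  rcases S.eq_empty_or_nonempty with rfl | hS
  · exact ⟨∅, Subset.rfl, by simp, by simp⟩
  set F := selfConv A with hF
  have hcA : (0 : ℝ) < #A := by exact_mod_cast hA.card_pos
  have heven : Even (2 * m) := even_two_mul m
  set E : ℝ := 4 * (12 / Q) ^ m * ∑ w ∈ X, (α ^ (2 * m) + F w ^ (2 * m)) with hE
  have hE0 : 0 < E := by
    have : 0 < ∑ w ∈ X, (α ^ (2 * m) + F w ^ (2 * m)) :=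
      sum_pos (fun w _ => add_pos_of_pos_of_nonneg (by positivity) (heven.pow_nonneg _)) hX
    positivity
  let f : (Fin k → G) → G → ℝ := fun a z => (∑ i, ind A (z - a i)) / k
  let err : (Fin k → G) → ℝ := fun a => ∑ z ∈ X, (f a z - F z) ^ (2 * m)
  have herr0 : ∀ a, 0 ≤ err a := fun a => sum_nonneg fun z _ => heven.pow_nonneg _
  have htot : ∑ a ∈ Fintype.piFinset (fun _ : Fin k => A), err a ≤ (#A : ℝ) ^ k * E := by
    rw [sum_comm, hE, mul_sum, mul_sum]
    refine sum_le_sum fun z _ => ?_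
    refine sum_moment_le (Y := fun a => ind A (z - a))
      (fun a _ => ⟨ind_nonneg _ _, ind_le_one _ _⟩)
      (selfConv_nonneg A z) (selfConv_le_one A z) ?_ hm hα hQ hk
    simp only [selfConv]; field_simp
  let L := (Fintype.piFinset (fun _ : Fin k => A)).filter fun a => err a ≤ 2 * E
  have hL : (#A : ℝ) ^ k ≤ 2 * #L := by
    have h1 := card_filter_add_card_filter_not (s := Fintype.piFinset (fun _ : Fin k => A))
      (fun a => err a ≤ 2 * E)
    have h2 : #(Fintype.piFinset (fun _ : Fin k => A)) = #A ^ k := by simp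
    rw [h2] at h1
    have h3 : (#((Fintype.piFinset (fun _ : Fin k => A)).filter fun a => ¬ err a ≤ 2 * E) : ℝ) *
        (2 * E) ≤ (#A : ℝ) ^ k * E := by
      refine le_trans ?_ htot
      rw [← nsmul_eq_mul]
      refine (card_nsmul_le_sum _ _ _ fun a ha => (not_le.1 (mem_filter.1 ha).2).le).trans ?_
      exact sum_le_sum_of_subset_of_nonneg (filter_subset _ _) fun a _ _ => herr0 a
    have h4 : (#L : ℝ) + #((Fintype.piFinset (fun _ : Fin k => A)).filter fun a =>
        ¬ err a ≤ 2 * E) = (#A : ℝ) ^ k := by exact_mod_cast h1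
    nlinarith
  have hBne : B.Nonempty := by
    obtain ⟨a, ha⟩ := hA
    obtain ⟨s, hs⟩ := hS
    exact ⟨_, hAS a ha s hs⟩
  let P := Fintype.piFinset (fun _ : Fin k => B)
  have hP : #P = #B ^ k := by simp [P]
  have hPne : P.Nonempty := by
    rw [← card_pos, hP]; exact pow_pos hBne.card_pos k
  let Tb : (Fin k → G) → Finset G := fun b => S.filter fun t => (fun i => b i + t) ∈ L
  have hdc : #S * #L ≤ ∑ b ∈ P, #(Tb b) := by
    have h1 := sum_card_bipartiteAbove_eq_sum_card_bipartiteBelow (s := P) (t := S)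
      (fun b t => (fun i => b i + t) ∈ L)
    simp only [bipartiteAbove, bipartiteBelow] at h1
    change _ ≤ ∑ b ∈ P, #(S.filter fun t => (fun i => b i + t) ∈ L)
    rw [h1, ← smul_eq_mul]
    refine card_nsmul_le_sum _ _ _ fun t ht => ?_
    refine card_le_card_of_injOn (fun a i => a i - t) ?_ ?_
    · intro a ha
      have ha' := (mem_filter.1 (mem_coe.1 ha)).1
      rw [Fintype.mem_piFinset] at ha'
      rw [mem_coe, mem_filter, Fintype.mem_piFinset]
      refine ⟨fun i => hAS _ (ha' i) _ ht, ?_⟩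
      simpa using ha
    · intro a _ b _ h
      funext i
      have := congrFun h i
      simpa using this
  obtain ⟨b, _, hb⟩ : ∃ b ∈ P, (#S * #L : ℝ) / #P ≤ #(Tb b) := by
    refine exists_le_of_sum_le hPne ?_
    rw [sum_const, nsmul_eq_mul, mul_div_cancel₀]
    · exact_mod_cast hdc
    · exact_mod_cast hPne.card_pos.ne'
  refine ⟨Tb b, filter_subset _ _, ?_, ?_⟩
  · have hP' : (0 : ℝ) < #P := by exact_mod_cast hPne.card_pos
    rw [div_le_iff₀ hP', hP] at hb
    push_cast at hb
    have : (#S : ℝ) * #A ^ k ≤ #S * (2 * #L) := by gcongr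
    linarith
  · intro t ht t' ht' Y hY hYt
    let g : G → ℝ := fun u => (∑ i, ind A (u - b i)) / k
    have hg : ∀ t ∈ Tb b, ∑ z ∈ X, (g (z - t) - F z) ^ (2 * m) ≤ 2 * E := by
      intro t ht
      have h1 := (mem_filter.1 (mem_filter.1 ht).2).2
      refine le_trans (le_of_eq ?_) h1
      refine sum_congr rfl fun z _ => ?_
      simp only [g, f]
      congr 3
      refine sum_congr rfl fun i _ => ?_
      congr 1; abel
    have h1 : ∑ w ∈ Y, (F (w + (t' - t)) - g (w - t)) ^ (2 * m) ≤ 2 * E := by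
      refine le_trans ?_ (hg t' ht')
      have h2 : ∑ w ∈ Y, (F (w + (t' - t)) - g (w - t)) ^ (2 * m) =
          ∑ z ∈ Y.image (· + (t' - t)), (g (z - t') - F z) ^ (2 * m) := by
        rw [sum_image (fun x _ y _ h => add_left_injective _ h)]
        refine sum_congr rfl fun w _ => ?_
        rw [← heven.neg_pow, neg_sub]
        have h4 : w + (t' - t) - t' = w - t := by abel
        rw [h4]
      rw [h2]
      exact sum_le_sum_of_subset_of_nonneg (image_subset_iff.2 hYt)
        fun _ _ _ => heven.pow_nonneg _
    have h3 : ∑ w ∈ Y, (g (w - t) - F w) ^ (2 * m) ≤ 2 * E :=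
      (sum_le_sum_of_subset_of_nonneg hY fun _ _ _ => heven.pow_nonneg _).trans (hg t ht)
    calc ∑ w ∈ Y, (F (w + (t' - t)) - F w) ^ (2 * m)
        ≤ ∑ w ∈ Y, 4 ^ m * ((F (w + (t' - t)) - g (w - t)) ^ (2 * m) +
            (g (w - t) - F w) ^ (2 * m)) := by
          refine sum_le_sum fun w _ => ?_
          refine le_trans (le_of_eq ?_) (add_pow_two_mul_le _ _ m)
          congr 1; ring
      _ ≤ 4 ^ m * (2 * E + 2 * E) := by
          rw [← mul_sum, sum_add_distrib]; gcongr
      _ = _ := by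
          rw [hE]
          have : (48 / Q) ^ m = 4 ^ m * (12 / Q) ^ m := by rw [← mul_pow]; ring_nf
          rw [this]; ring

end AlmostPeriods

section Smoothing
variable {G : Type*} [AddCommGroup G] [Fintype G] [DecidableEq G]

/-- The average of `f` over the shifts `t - t'` with `t, t' ∈ T`. -/
noncomputable def smooth (T : Finset G) (f : G → ℝ) (z : G) : ℝ :=
  (∑ u ∈ T ×ˢ T, f (z + (u.1 - u.2))) / #(T ×ˢ T)

lemma le_smooth {T : Finset G} (hT : T.Nonempty) {f : G → ℝ} {z : G} {v : ℝ}
    (h : ∀ t ∈ T, ∀ t' ∈ T, v ≤ f (z + (t - t'))) : v ≤ smooth T f z := by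
  have hc : (0 : ℝ) < #(T ×ˢ T) := by exact_mod_cast (hT.product hT).card_pos
  rw [smooth, le_div_iff₀ hc, mul_comm, ← nsmul_eq_mul]
  exact card_nsmul_le_sum _ _ _ fun u hu => h _ (mem_product.1 hu).1 _ (mem_product.1 hu).2

lemma smooth_le {T : Finset G} (hT : T.Nonempty) {f : G → ℝ} {z : G} {v : ℝ}
    (h : ∀ t ∈ T, ∀ t' ∈ T, f (z + (t - t')) ≤ v) : smooth T f z ≤ v := by
  have hc : (0 : ℝ) < #(T ×ˢ T) := by exact_mod_cast (hT.product hT).card_pos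
  rw [smooth, div_le_iff₀ hc, mul_comm _ (#(T ×ˢ T) : ℝ), ← nsmul_eq_mul]
  exact sum_le_card_nsmul _ _ _ fun u hu => h _ (mem_product.1 hu).1 _ (mem_product.1 hu).2

lemma smooth_sub (T : Finset G) (f g : G → ℝ) : smooth T (f - g) = smooth T f - smooth T g := by
  funext z; simp [smooth, sum_sub_distrib, sub_div]

lemma smooth_comm (S T : Finset G) (f : G → ℝ) :
    smooth S (smooth T f) = smooth T (smooth S f) := by
  funext z
  simp only [smooth, ← sum_div]
  rw [sum_comm, div_right_comm]
  congr 2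
  refine sum_congr rfl fun u _ => sum_congr rfl fun v _ => ?_
  congr 1; abel

lemma smooth_iterate_comm (S T : Finset G) (f : G → ℝ) (l : ℕ) :
    smooth S ((smooth T)^[l] f) = (smooth T)^[l] (smooth S f) :=
  Function.Commute.iterate_right (f := smooth S) (g := smooth T) (fun f => smooth_comm S T f) l f

lemma sum_smooth_pow_le {T X X' : Finset G} (hT : T.Nonempty)
    (hX : ∀ x ∈ X, ∀ t ∈ T, ∀ t' ∈ T, x + (t - t') ∈ X') (f : G → ℝ) {m : ℕ} (hm : 1 ≤ m) :
    ∑ z ∈ X, smooth T f z ^ (2 * m) ≤ ∑ z ∈ X', f z ^ (2 * m) := by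
  have hc : (0 : ℝ) < #(T ×ˢ T) := by exact_mod_cast (hT.product hT).card_pos
  refine (sum_le_sum fun z _ => mean_pow_le (T ×ˢ T) (fun u => f (z + (u.1 - u.2))) m hm).trans ?_
  rw [← sum_div, sum_comm, div_le_iff₀ hc, mul_comm _ (#(T ×ˢ T) : ℝ), ← nsmul_eq_mul]
  refine sum_le_card_nsmul _ _ _ fun u hu => ?_
  rw [← sum_image (f := fun z => f z ^ (2 * m)) (g := (· + (u.1 - u.2)))
    (fun x _ y _ h => add_left_injective _ h)]
  exact sum_le_sum_of_subset_of_nonneg (image_subset_iff.2 fun x hx =>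
    hX x hx _ (mem_product.1 hu).1 _ (mem_product.1 hu).2) fun _ _ _ => (even_two_mul m).pow_nonneg _

lemma sum_smooth_sub_pow_le {T X : Finset G} (hT : T.Nonempty) (f : G → ℝ) {m : ℕ} (hm : 1 ≤ m)
    {C : ℝ} (h : ∀ t ∈ T, ∀ t' ∈ T, ∑ z ∈ X, (f (z + (t - t')) - f z) ^ (2 * m) ≤ C) :
    ∑ z ∈ X, (smooth T f z - f z) ^ (2 * m) ≤ C := by
  have hc : (0 : ℝ) < #(T ×ˢ T) := by exact_mod_cast (hT.product hT).card_pos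
  have h1 : ∀ z, smooth T f z - f z =
      (∑ u ∈ T ×ˢ T, (f (z + (u.1 - u.2)) - f z)) / #(T ×ˢ T) := by
    intro z
    rw [sum_sub_distrib, sub_div, sum_const, nsmul_eq_mul, mul_div_cancel_left₀ _ hc.ne', smooth]
  simp only [h1]
  refine (sum_le_sum fun z _ => mean_pow_le (T ×ˢ T) (fun u => f (z + (u.1 - u.2)) - f z)
    m hm).trans ?_
  rw [← sum_div, sum_comm, div_le_iff₀ hc, mul_comm _ (#(T ×ˢ T) : ℝ), ← nsmul_eq_mul]
  exact sum_le_card_nsmul _ _ _ fun u hu => h _ (mem_product.1 hu).1 _ (mem_product.1 hu).2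

lemma sum_smooth_iterate_pow_le {T : Finset G} {X : ℕ → Finset G} (hT : T.Nonempty)
    (hX : ∀ i, ∀ x ∈ X i, ∀ t ∈ T, ∀ t' ∈ T, x + (t - t') ∈ X (i + 1)) {m : ℕ} (hm : 1 ≤ m)
    (i : ℕ) (f : G → ℝ) :
    ∑ z ∈ X 0, (smooth T)^[i] f z ^ (2 * m) ≤ ∑ z ∈ X i, f z ^ (2 * m) := by
  induction i generalizing f with
  | zero => simp
  | succ i ih =>
    rw [Function.iterate_succ_apply]
    exact (ih _).trans (sum_smooth_pow_le hT (hX i) f hm)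

lemma smooth_iterate_sub (T : Finset G) (f : G → ℝ) (l : ℕ) (z : G) :
    (smooth T)^[l] f z - f z = ∑ i ∈ range l, (smooth T)^[i] (smooth T f - f) z := by
  have hlin : ∀ i, ∀ f g : G → ℝ, (smooth T)^[i] (f - g) = (smooth T)^[i] f - (smooth T)^[i] g := by
    intro i
    induction i with
    | zero => simp
    | succ i ih => intro f g; simp only [Function.iterate_succ_apply, smooth_sub, ih]
  simp only [hlin, Pi.sub_apply, ← Function.iterate_succ_apply]
  rw [sum_range_sub (fun i => (smooth T)^[i] f z)]
  simp

lemma sum_smooth_iterate_sub_pow_le {T : Finset G} {X : ℕ → Finset G} (hT : T.Nonempty)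
    (hX : ∀ i, ∀ x ∈ X i, ∀ t ∈ T, ∀ t' ∈ T, x + (t - t') ∈ X (i + 1)) {m : ℕ} (hm : 1 ≤ m)
    (f : G → ℝ) {l : ℕ} {C : ℝ}
    (h : ∀ i < l, ∑ z ∈ X i, (smooth T f z - f z) ^ (2 * m) ≤ C) :
    ∑ z ∈ X 0, ((smooth T)^[l] f z - f z) ^ (2 * m) ≤ (l : ℝ) ^ (2 * m) * C := by
  rcases Nat.eq_zero_or_pos l with rfl | hl
  · have : 2 * m ≠ 0 := by omega
    simp [this]
  have hl' : (0 : ℝ) < l := by exact_mod_cast hl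
  have h1 : ∀ z, ((smooth T)^[l] f z - f z) ^ (2 * m) ≤
      (l : ℝ) ^ (2 * m) * ((∑ i ∈ range l, (smooth T)^[i] (smooth T f - f) z ^ (2 * m)) / l) := by
    intro z
    have := mean_pow_le (range l) (fun i => (smooth T)^[i] (smooth T f - f) z) m hm
    rw [card_range, div_pow, div_le_iff₀ (by positivity)] at this
    rw [smooth_iterate_sub]
    linarith
  refine (sum_le_sum fun z _ => h1 z).trans ?_
  rw [← mul_sum, ← sum_div, sum_comm]
  refine mul_le_mul_of_nonneg_left ?_ (by positivity)
  rw [div_le_iff₀ hl', mul_comm C]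
  have h2 : ∀ i ∈ range l, ∑ z ∈ X 0, (smooth T)^[i] (smooth T f - f) z ^ (2 * m) ≤ C :=
    fun i hi => (sum_smooth_iterate_pow_le hT hX hm i _).trans (h i (mem_range.1 hi))
  simpa using sum_le_card_nsmul _ _ _ h2

lemma le_smooth_iterate {T : Finset G} {X : ℕ → Finset G} (hT : T.Nonempty)
    (hX : ∀ i, ∀ x ∈ X i, ∀ t ∈ T, ∀ t' ∈ T, x + (t - t') ∈ X (i + 1)) {v : ℝ} (i : ℕ)
    (f : G → ℝ) (h : ∀ z ∈ X i, v ≤ f z) {z : G} (hz : z ∈ X 0) : v ≤ (smooth T)^[i] f z := by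
  induction i generalizing f with
  | zero => exact h z hz
  | succ i ih =>
    rw [Function.iterate_succ_apply]
    exact ih _ fun z hz => le_smooth hT fun t ht t' ht' => h _ (hX i z hz t ht t' ht')

lemma smooth_iterate_le {T : Finset G} (hT : T.Nonempty) {v : ℝ} (i : ℕ)
    (f : G → ℝ) (h : ∀ z, f z ≤ v) (z : G) : (smooth T)^[i] f z ≤ v := by
  induction i generalizing f with
  | zero => exact h z
  | succ i ih =>
    rw [Function.iterate_succ_apply]
    exact ih _ fun z => smooth_le hT fun t _ t' _ => h _

/-- The mean of a character over a finite set. -/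
noncomputable def charMean (T : Finset G) (γ : AddChar G ℂ) : ℂ := (∑ t ∈ T, γ t) / #T

lemma norm_charMean_le_one (T : Finset G) (γ : AddChar G ℂ) : ‖charMean T γ‖ ≤ 1 := by
  rw [charMean, norm_div, Complex.norm_natCast]
  refine div_le_one_of_le₀ ((norm_sum_le _ _).trans ?_) (Nat.cast_nonneg _)
  simp [AddChar.norm_apply]

lemma norm_charMean_sub_one_le {T : Finset G} (hT : T.Nonempty) {γ : AddChar G ℂ} {s : ℝ}
    (h : ∀ t ∈ T, ‖γ t - 1‖ ≤ s) : ‖charMean T γ - 1‖ ≤ s := by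
  have hc : (0 : ℝ) < #T := by exact_mod_cast hT.card_pos
  have hc' : (#T : ℂ) ≠ 0 := by exact_mod_cast hT.card_pos.ne'
  have : charMean T γ - 1 = (∑ t ∈ T, (γ t - 1)) / #T := by
    rw [sum_sub_distrib, charMean]; simp; field_simp
  rw [this, norm_div, Complex.norm_natCast, div_le_iff₀ hc, mul_comm s, ← nsmul_eq_mul]
  exact (norm_sum_le _ _).trans (sum_le_card_nsmul _ _ _ h)

lemma one_sub_norm_charMean_sq_le {T : Finset G} (hT : T.Nonempty) {γ : AddChar G ℂ} {s : ℝ}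
    (h : ∀ t ∈ T, ‖γ t - 1‖ ≤ s) : 1 - ‖charMean T γ‖ ^ 2 ≤ 2 * s := by
  have h1 := norm_charMean_sub_one_le hT h
  have h2 := norm_sub_norm_le (1 : ℂ) (charMean T γ)
  rw [norm_one, norm_sub_rev] at h2
  have h3 := norm_charMean_le_one T γ
  have h4 := norm_nonneg (charMean T γ)
  nlinarith

lemma mean_char_sub {T : Finset G} (γ : AddChar G ℂ) :
    (∑ u ∈ T ×ˢ T, γ (u.1 - u.2)) / #(T ×ˢ T) = ((‖charMean T γ‖ ^ 2 : ℝ) : ℂ) := by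
  rw [Complex.ofReal_pow, ← Complex.mul_conj', charMean, map_div₀, map_sum, card_product,
    div_mul_div_comm, sum_mul_sum, sum_product]
  congr 1
  · refine sum_congr rfl fun x _ => sum_congr rfl fun y _ => ?_
    rw [← AddChar.map_neg_eq_conj, ← AddChar.map_add_eq_mul, sub_eq_add_neg]
  · simp

lemma ofReal_smooth {T : Finset G} {f : G → ℝ} {c : AddChar G ℂ → ℂ}
    (hf : ∀ z, (f z : ℂ) = ∑ γ, c γ * γ z) (z : G) :
    (smooth T f z : ℂ) = ∑ γ, (c γ * ((‖charMean T γ‖ ^ 2 : ℝ) : ℂ)) * γ z := by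
  rw [smooth]
  push_cast
  simp only [hf]
  rw [sum_comm, sum_div]
  refine sum_congr rfl fun γ _ => ?_
  have h := mean_char_sub (T := T) γ
  push_cast at h
  rw [← h, ← mul_sum]
  simp only [AddChar.map_add_eq_mul]
  rw [← mul_sum]
  ring

lemma ofReal_smooth_iterate {T : Finset G} {f : G → ℝ} {c : AddChar G ℂ → ℂ}
    (hf : ∀ z, (f z : ℂ) = ∑ γ, c γ * γ z) (l : ℕ) (z : G) :
    ((smooth T)^[l] f z : ℂ) = ∑ γ, (c γ * ((‖charMean T γ‖ ^ (2 * l) : ℝ) : ℂ)) * γ z := by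
  induction l generalizing f c z with
  | zero => simp [hf]
  | succ l ih =>
    rw [Function.iterate_succ_apply, ih (ofReal_smooth hf)]
    refine sum_congr rfl fun γ _ => ?_
    push_cast; ring

lemma norm_sq_sum_char (A : Finset G) (γ : AddChar G ℂ) :
    ((‖∑ a ∈ A, γ (-a)‖ ^ 2 : ℝ) : ℂ) = ∑ a ∈ A, ∑ b ∈ A, γ (b - a) := by
  rw [Complex.ofReal_pow, ← Complex.mul_conj', map_sum, sum_mul_sum]
  refine sum_congr rfl fun x _ => sum_congr rfl fun y _ => ?_
  rw [← AddChar.map_neg_eq_conj, neg_neg, ← AddChar.map_add_eq_mul, sub_eq_neg_add]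

lemma sum_norm_sq_sum_char (A : Finset G) :
    ∑ γ : AddChar G ℂ, ‖∑ a ∈ A, γ (-a)‖ ^ 2 = Fintype.card G * #A := by
  have h : ((∑ γ : AddChar G ℂ, ‖∑ a ∈ A, γ (-a)‖ ^ 2 : ℝ) : ℂ) =
      (((Fintype.card G : ℝ) * #A : ℝ) : ℂ) := by
    push_cast
    have h1 := fun γ : AddChar G ℂ => norm_sq_sum_char A γ
    push_cast at h1
    simp only [h1]
    rw [sum_comm]
    simp_rw [sum_comm (s := univ) (t := A), AddChar.sum_apply_eq_ite, sub_eq_zero]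
    simp [mul_comm]
  exact_mod_cast h

lemma ofReal_selfConv (A : Finset G) (z : G) :
    (selfConv A z : ℂ) =
      ∑ γ : AddChar G ℂ, ((∑ a ∈ A, γ (-a)) ^ 2 / (#A * Fintype.card G)) * γ z := by
  have hG : (Fintype.card G : ℂ) ≠ 0 := by exact_mod_cast Fintype.card_ne_zero
  have h1 : ∀ γ : AddChar G ℂ, ((∑ a ∈ A, γ (-a)) ^ 2 / (#A * Fintype.card G)) * γ z =
      (∑ a ∈ A, ∑ b ∈ A, γ (z - a - b)) / (#A * Fintype.card G) := by
    intro γ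
    rw [sq, sum_mul_sum, div_mul_eq_mul_div, sum_mul]
    congr 1
    refine sum_congr rfl fun x _ => ?_
    rw [sum_mul]
    refine sum_congr rfl fun y _ => ?_
    rw [← AddChar.map_add_eq_mul, ← AddChar.map_add_eq_mul]
    congr 1; abel
  simp only [h1]
  rw [← sum_div, sum_comm]
  simp_rw [sum_comm (s := univ) (t := A), AddChar.sum_apply_eq_ite, sub_eq_zero]
  rw [selfConv]
  push_cast
  simp only [ind, Finset.sum_ite_eq]
  rw [← div_div, div_right_comm]
  congr 1
  rw [sum_div]
  refine sum_congr rfl fun a _ => ?_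
  split_ifs <;> simp [hG]

lemma abs_smooth_smooth_iterate_sub_le {A T W : Finset G} {l : ℕ} {ε : ℝ}
    (hA : A.Nonempty)
    (h : ∀ γ : AddChar G ℂ, ‖charMean T γ‖ ^ (2 * l) * (1 - ‖charMean W γ‖ ^ 2) ≤ ε) (z : G) :
    |smooth W ((smooth T)^[l] (selfConv A)) z - (smooth T)^[l] (selfConv A) z| ≤ ε := by
  have hc : (0 : ℝ) < #A * Fintype.card G := by
    have : 0 < #A * Fintype.card G := Nat.mul_pos hA.card_pos Fintype.card_pos
    exact_mod_cast this
  rw [← Real.norm_eq_abs, ← Complex.norm_real, Complex.ofReal_sub,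
    ofReal_smooth (ofReal_smooth_iterate (ofReal_selfConv A) l),
    ofReal_smooth_iterate (ofReal_selfConv A) l, ← sum_sub_distrib]
  have hterm : ∀ γ : AddChar G ℂ, ‖((∑ a ∈ A, γ (-a)) ^ 2 / (#A * Fintype.card G) *
      ((‖charMean T γ‖ ^ (2 * l) : ℝ) : ℂ) * ((‖charMean W γ‖ ^ 2 : ℝ) : ℂ)) * γ z -
      ((∑ a ∈ A, γ (-a)) ^ 2 / (#A * Fintype.card G) * ((‖charMean T γ‖ ^ (2 * l) : ℝ) : ℂ)) * γ z‖ ≤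
      ‖∑ a ∈ A, γ (-a)‖ ^ 2 * (ε / (#A * Fintype.card G)) := by
    intro γ
    have hre : ((∑ a ∈ A, γ (-a)) ^ 2 / (#A * Fintype.card G) *
      ((‖charMean T γ‖ ^ (2 * l) : ℝ) : ℂ) * ((‖charMean W γ‖ ^ 2 : ℝ) : ℂ)) * γ z -
      ((∑ a ∈ A, γ (-a)) ^ 2 / (#A * Fintype.card G) * ((‖charMean T γ‖ ^ (2 * l) : ℝ) : ℂ)) * γ z =
      -((∑ a ∈ A, γ (-a)) ^ 2 / (((#A * Fintype.card G : ℝ)) : ℂ) *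
        ((‖charMean T γ‖ ^ (2 * l) * (1 - ‖charMean W γ‖ ^ 2) : ℝ) : ℂ) * γ z) := by
      push_cast; ring
    have hnn : 0 ≤ ‖charMean T γ‖ ^ (2 * l) * (1 - ‖charMean W γ‖ ^ 2) := by
      have := norm_charMean_le_one W γ
      have h0 := norm_nonneg (charMean W γ)
      exact mul_nonneg (by positivity) (by nlinarith)
    rw [hre, norm_neg, norm_mul, norm_mul, AddChar.norm_apply, mul_one, norm_div, norm_pow,
      Complex.norm_real, Complex.norm_real, Real.norm_of_nonneg hc.le, Real.norm_of_nonneg hnn]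
    rw [div_mul_eq_mul_div, ← mul_div_assoc]
    have := h γ
    gcongr
  refine (norm_sum_le_of_le _ fun γ _ => hterm γ).trans ?_
  rw [← sum_mul, sum_norm_sq_sum_char]
  refine le_of_eq ?_
  field_simp

end Smoothing

section Chang
variable {G : Type*} [AddCommGroup G] [Fintype G]

open Classical in
/-- Functions to `{-1, 0, 1}` supported on `Δ`. -/
noncomputable def signs (Δ : Finset (AddChar G ℂ)) : Finset (AddChar G ℂ → ℤ) :=
  Fintype.piFinset fun γ => if γ ∈ Δ then {-1, 0, 1} else {0}

lemma mem_signs {Δ : Finset (AddChar G ℂ)} {e : AddChar G ℂ → ℤ} :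
    e ∈ signs Δ ↔ ∀ γ, (γ ∈ Δ → e γ = -1 ∨ e γ = 0 ∨ e γ = 1) ∧ (γ ∉ Δ → e γ = 0) := by
  rw [signs, Fintype.mem_piFinset]
  refine forall_congr' fun γ => ?_
  split_ifs with h <;> simp [h]

lemma zero_mem_signs (Δ : Finset (AddChar G ℂ)) : (0 : AddChar G ℂ → ℤ) ∈ signs Δ := by
  simp [mem_signs]

lemma neg_mem_signs {Δ : Finset (AddChar G ℂ)} {e : AddChar G ℂ → ℤ} (h : e ∈ signs Δ) :
    -e ∈ signs Δ := by
  rw [mem_signs] at h ⊢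
  intro γ
  refine ⟨fun hγ => ?_, fun hγ => ?_⟩
  · have := (h γ).1 hγ
    simp only [Pi.neg_apply]; omega
  · have := (h γ).2 hγ
    simp [this]

/-- The integer combination of characters with coefficients `e`. -/
noncomputable def comb (e : AddChar G ℂ → ℤ) : AddChar G ℂ := ∑ γ, e γ • γ

lemma comb_neg (e : AddChar G ℂ → ℤ) : comb (-e) = -comb e := by
  simp [comb]

lemma comb_apply (e : AddChar G ℂ → ℤ) (x : G) : comb e x = ∏ γ, γ x ^ e γ := by
  simp [comb, AddChar.sum_apply, AddChar.zsmul_apply]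

/-- The Fourier coefficient of `β` at `γ`. -/
noncomputable def coeff (β : G → ℝ) (γ : AddChar G ℂ) : ℂ := ∑ x, (β x : ℂ) * γ x

lemma norm_coeff_neg (β : G → ℝ) (γ : AddChar G ℂ) : ‖coeff β (-γ)‖ = ‖coeff β γ‖ := by
  have : coeff β (-γ) = (starRingEnd ℂ) (coeff β γ) := by
    simp only [coeff, map_sum, map_mul, Complex.conj_ofReal]
    refine sum_congr rfl fun x _ => ?_
    rw [← AddChar.map_neg_eq_conj, AddChar.neg_apply]
  rw [this, RCLike.norm_conj]

lemma sum_mul_prod_le {β : G → ℝ} (hβ1 : ∑ x, β x = 1)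
    {Δ : Finset (AddChar G ℂ)} {η C S : ℝ} (hη : 0 ≤ η) (hC : 0 ≤ C) (hS : 0 ≤ S)
    (hdis : ∀ e ∈ signs Δ, e ≠ 0 → ‖coeff β (comb e)‖ ≤ η)
    {c : AddChar G ℂ → ℂ} (hc : ∀ γ, ‖c γ‖ = 1) :
    ∑ x, β x * ∏ γ ∈ Δ, (C + (c γ * γ x).re * S) ≤ C ^ #Δ + η * (C + S) ^ #Δ := by
  classical
  set w : AddChar G ℂ → ℤ → ℂ := fun γ j =>
    if γ ∈ Δ then (if j = 0 then (C : ℂ) else if j = 1 then S / 2 * c γ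
      else S / 2 * (starRingEnd ℂ) (c γ)) else 1 with hw
  have hprod : ∀ x, ((∏ γ ∈ Δ, (C + (c γ * γ x).re * S) : ℝ) : ℂ) =
      ∑ e ∈ signs Δ, (∏ γ, w γ (e γ)) * comb e x := by
    intro x
    have h1 : ∏ γ : AddChar G ℂ, ∑ j ∈ (if γ ∈ Δ then ({-1, 0, 1} : Finset ℤ) else {0}),
        w γ j * γ x ^ j = ∑ e ∈ signs Δ, ∏ γ, (w γ (e γ) * γ x ^ e γ) := by
      rw [signs, prod_univ_sum]
    simp only [comb_apply, ← prod_mul_distrib]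
    rw [← h1]
    push_cast
    rw [← prod_subset (subset_univ Δ)]
    · refine prod_congr rfl fun γ hγ => ?_
      have h2 : (starRingEnd ℂ) (c γ) * (γ x)⁻¹ = (starRingEnd ℂ) (c γ * γ x) := by
        rw [map_mul, ← AddChar.map_neg_eq_conj, AddChar.map_neg_eq_inv]
      simp only [hγ, if_true, hw]
      rw [sum_insert (by decide), sum_insert (by decide), sum_singleton]
      simp only [zpow_neg_one, zpow_zero, zpow_one, Complex.re_eq_add_conj, ← h2]
      norm_num
      ring
    · intro γ _ hγ
      simp [hγ, hw]
  have hnorm : ∑ e ∈ signs Δ, ∏ γ, ‖w γ (e γ)‖ = (C + S) ^ #Δ := by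
    rw [signs, ← prod_univ_sum (f := fun γ j => ‖w γ j‖), ← prod_const,
      ← prod_subset (subset_univ Δ)]
    · refine prod_congr rfl fun γ hγ => ?_
      simp only [hγ, if_true, hw]
      rw [sum_insert (by decide), sum_insert (by decide), sum_singleton]
      simp [hc, abs_of_nonneg hC, abs_of_nonneg hS]
      ring
    · intro γ _ hγ
      simp [hγ, hw]
  have hcomb0 : comb (0 : AddChar G ℂ → ℤ) = 0 := by simp [comb]
  have hmain : ((∑ x, β x * ∏ γ ∈ Δ, (C + (c γ * γ x).re * S) : ℝ) : ℂ) =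
      ∑ e ∈ signs Δ, (∏ γ, w γ (e γ)) * coeff β (comb e) := by
    rw [Complex.ofReal_sum]
    simp only [Complex.ofReal_mul (β _), hprod, coeff, mul_sum]
    rw [sum_comm]
    refine sum_congr rfl fun e _ => sum_congr rfl fun x _ => ?_
    ring
  have h0 : (∏ γ, w γ ((0 : AddChar G ℂ → ℤ) γ)) * coeff β (comb 0) = ((C ^ #Δ : ℝ) : ℂ) := by
    have : coeff β (comb 0) = 1 := by
      rw [hcomb0, coeff]
      simp only [AddChar.zero_apply, mul_one]
      exact_mod_cast congrArg (fun t : ℝ => (t : ℂ)) hβ1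
    rw [this, mul_one, ← prod_subset (subset_univ Δ)]
    · push_cast
      rw [← prod_const]
      refine prod_congr rfl fun γ hγ => ?_
      simp [hw, hγ]
    · intro γ _ hγ
      simp [hγ, hw]
  rw [← add_sum_erase _ _ (zero_mem_signs Δ), h0] at hmain
  have h3 : ((∑ x, β x * ∏ γ ∈ Δ, (C + (c γ * γ x).re * S) - C ^ #Δ : ℝ) : ℂ) =
      ∑ e ∈ (signs Δ).erase 0, (∏ γ, w γ (e γ)) * coeff β (comb e) := by
    rw [Complex.ofReal_sub, hmain]; ring
  have h4 : |∑ x, β x * ∏ γ ∈ Δ, (C + (c γ * γ x).re * S) - C ^ #Δ| ≤ η * (C + S) ^ #Δ := by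
    rw [← Real.norm_eq_abs, ← Complex.norm_real, h3, ← hnorm, mul_sum]
    refine (norm_sum_le _ _).trans ((sum_le_sum fun e he => ?_).trans
      (sum_le_sum_of_subset_of_nonneg (erase_subset 0 _) fun e _ _ =>
        mul_nonneg hη (prod_nonneg fun γ _ => norm_nonneg _)))
    rw [norm_mul, norm_prod, mul_comm]
    exact mul_le_mul_of_nonneg_right (hdis e (mem_of_mem_erase he) (ne_of_mem_erase he))
      (prod_nonneg fun γ _ => norm_nonneg _)
  linarith [(abs_le.1 h4).2]

lemma exp_card_dissociated_le {β : G → ℝ} (hβ0 : ∀ x, 0 ≤ β x) (hβ1 : ∑ x, β x = 1)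
    {T : Finset G} (hT : T.Nonempty) {M : ℝ} (hM : 0 ≤ M) (hβT : ∀ x ∈ T, 1 ≤ M * #T * β x)
    {Δ : Finset (AddChar G ℂ)} (hΔ : ∀ γ ∈ Δ, 1 / 2 ≤ ‖charMean T γ‖)
    {η : ℝ} (hη : 0 ≤ η) (hηn : η * Real.exp (#Δ / 2) ≤ 1)
    (hdis : ∀ e ∈ signs Δ, e ≠ 0 → ‖coeff β (comb e)‖ ≤ η) :
    Real.exp (#Δ / 8) ≤ 2 * M := by
  classical
  have hTc : (0 : ℝ) < #T := by exact_mod_cast hT.card_pos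
  have hcex : ∀ z : ℂ, ∃ u : ℂ, ‖u‖ = 1 ∧ u * z = ‖z‖ := fun z => by
    rcases eq_or_ne z 0 with rfl | hz
    · exact ⟨1, by simp⟩
    · refine ⟨‖z‖ / z, ?_, ?_⟩
      · rw [norm_div, Complex.norm_real, norm_norm, div_self (norm_ne_zero_iff.2 hz)]
      · field_simp
  choose u hu1 hu2 using hcex
  set c : AddChar G ℂ → ℂ := fun γ => u (charMean T γ) with hcdef
  have hc : ∀ γ, ‖c γ‖ = 1 := fun γ => hu1 _
  set U : G → ℝ := fun x => ∑ γ ∈ Δ, (c γ * γ x).re with hU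
  have hmeanU : (#Δ : ℝ) / 2 * #T ≤ ∑ x ∈ T, U x := by
    have h1 : ∀ γ, ∑ x ∈ T, (c γ * γ x).re = ‖charMean T γ‖ * #T := by
      intro γ
      rw [← Complex.re_sum, ← mul_sum]
      have : ∑ x ∈ T, γ x = charMean T γ * #T := by
        rw [charMean, div_mul_cancel₀]; exact_mod_cast hTc.ne'
      rw [this, ← mul_assoc, hu2, ← Complex.ofReal_natCast, ← Complex.ofReal_mul,
        Complex.ofReal_re]
    rw [hU, sum_comm]
    simp only [h1]
    rw [← sum_mul]
    refine mul_le_mul_of_nonneg_right ?_ hTc.le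
    have := card_nsmul_le_sum Δ (fun γ => ‖charMean T γ‖) (1 / 2) hΔ
    rw [nsmul_eq_mul] at this
    linarith
  have hlow : Real.exp (#Δ / 4) * #T ≤ ∑ x ∈ T, Real.exp (U x * (1 / 2)) := by
    have h1 : ∀ x ∈ T, Real.exp (#Δ / 4) * (1 + (U x / 2 - #Δ / 4)) ≤
        Real.exp (U x * (1 / 2)) := by
      intro x _
      have h2 : Real.exp (U x * (1 / 2)) = Real.exp (#Δ / 4) * Real.exp (U x / 2 - #Δ / 4) := by
        rw [← Real.exp_add]; ring_nf
      rw [h2]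
      refine mul_le_mul_of_nonneg_left ?_ (Real.exp_pos _).le
      linarith [Real.add_one_le_exp (U x / 2 - #Δ / 4)]
    refine le_trans ?_ (sum_le_sum h1)
    rw [← mul_sum]
    refine mul_le_mul_of_nonneg_left ?_ (Real.exp_pos _).le
    rw [sum_add_distrib, sum_sub_distrib, ← sum_div]
    simp only [sum_const, nsmul_eq_mul, mul_one]
    linarith
  have hup : ∑ x ∈ T, Real.exp (U x * (1 / 2)) ≤
      M * #T * ∑ x, β x * ∏ γ ∈ Δ, (Real.cosh (1 / 2) + (c γ * γ x).re * Real.sinh (1 / 2)) := by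
    have h1 : ∀ x, Real.exp (U x * (1 / 2)) ≤
        ∏ γ ∈ Δ, (Real.cosh (1 / 2) + (c γ * γ x).re * Real.sinh (1 / 2)) := by
      intro x
      rw [hU, sum_mul, Real.exp_sum]
      refine prod_le_prod (fun _ _ => (Real.exp_pos _).le) fun γ _ => ?_
      refine Real.exp_mul_le_cosh_add_mul_sinh ?_ _
      refine (Complex.abs_re_le_norm _).trans ?_
      rw [norm_mul, hc, AddChar.norm_apply, one_mul]
    have hMT : 0 ≤ M * #T := mul_nonneg hM hTc.le
    rw [mul_sum]
    calc ∑ x ∈ T, Real.exp (U x * (1 / 2))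
        ≤ ∑ x ∈ T, M * #T * (β x *
          ∏ γ ∈ Δ, (Real.cosh (1 / 2) + (c γ * γ x).re * Real.sinh (1 / 2))) := by
          refine sum_le_sum fun x hx => ?_
          have h2 := hβT x hx
          have h3 := h1 x
          have h4 := (Real.exp_pos (U x * (1 / 2))).le
          rw [← mul_assoc]
          calc Real.exp (U x * (1 / 2)) = 1 * Real.exp (U x * (1 / 2)) := (one_mul _).symm
            _ ≤ _ := mul_le_mul h2 h3 h4 (by linarith)
      _ ≤ _ := by
          refine sum_le_sum_of_subset_of_nonneg (subset_univ _) fun x _ _ => ?_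
          exact mul_nonneg hMT (mul_nonneg (hβ0 x) ((Real.exp_pos _).le.trans (h1 x)))
  have hprod := sum_mul_prod_le hβ1 hη (Real.cosh_pos (1 / 2)).le
    (Real.sinh_nonneg_iff.2 (by norm_num : (0 : ℝ) ≤ 1 / 2)) hdis hc
  rw [Real.cosh_add_sinh] at hprod
  have hcosh : Real.cosh (1 / 2) ^ #Δ ≤ Real.exp (#Δ / 8) := by
    have := Real.cosh_le_exp_half_sq (1 / 2)
    calc _ ≤ Real.exp ((1 / 2) ^ 2 / 2) ^ #Δ :=
          pow_le_pow_left₀ (Real.cosh_pos _).le this _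
      _ = _ := by rw [← Real.exp_nat_mul]; ring_nf
  have hexp : Real.exp (1 / 2) ^ #Δ = Real.exp (#Δ / 2) := by
    rw [← Real.exp_nat_mul]; ring_nf
  rw [hexp] at hprod
  have h1e : 1 ≤ Real.exp (#Δ / 8) := Real.one_le_exp (by positivity)
  have h5 : Real.exp (#Δ / 4) * #T ≤ M * #T * (2 * Real.exp (#Δ / 8)) := by
    refine hlow.trans (hup.trans (mul_le_mul_of_nonneg_left ?_ (mul_nonneg hM hTc.le)))
    linarith
  have h6 : Real.exp (#Δ / 4) = Real.exp (#Δ / 8) * Real.exp (#Δ / 8) := by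
    rw [← Real.exp_add]; ring_nf
  rw [h6] at h5
  have h7 : 0 < Real.exp (#Δ / 8) * #T := mul_pos (Real.exp_pos _) hTc
  refine le_of_mul_le_mul_right ?_ h7
  linarith

/-- A relative form of Chang's theorem: the large spectrum of `T` is controlled by few characters,
up to the large spectrum of a weight `β` dominating `T`. -/
lemma exists_comb_coeff {β : G → ℝ} (hβ0 : ∀ x, 0 ≤ β x) (hβ1 : ∑ x, β x = 1)
    {T : Finset G} (hT : T.Nonempty) {M : ℝ} (hM : 0 ≤ M) (hβT : ∀ x ∈ T, 1 ≤ M * #T * β x)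
    {n : ℕ} {η : ℝ} (hη : 0 ≤ η) (hη1 : η < 1) (hηn : η * Real.exp (n / 2) ≤ 1)
    (hn : 2 * M < Real.exp (n / 8)) :
    ∃ Δ : Finset (AddChar G ℂ), #Δ ≤ n ∧ ∀ γ, 1 / 2 ≤ ‖charMean T γ‖ →
      ∃ e ∈ signs Δ, η < ‖coeff β (γ + comb e)‖ := by
  classical
  set F : Finset (Finset (AddChar G ℂ)) := univ.filter fun Δ => #Δ ≤ n ∧
    (∀ γ ∈ Δ, 1 / 2 ≤ ‖charMean T γ‖) ∧ ∀ e ∈ signs Δ, e ≠ 0 → ‖coeff β (comb e)‖ ≤ η with hF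
  have hFne : F.Nonempty := by
    refine ⟨∅, ?_⟩
    simp only [hF, mem_filter, mem_univ, true_and]
    refine ⟨by simp, by simp, fun e he hne => (hne ?_).elim⟩
    funext γ
    exact ((mem_signs.1 he) γ).2 (notMem_empty _)
  obtain ⟨Δ, hΔF, hmax⟩ := exists_max_image F card hFne
  simp only [hF, mem_filter, mem_univ, true_and] at hΔF
  obtain ⟨hΔn, hΔT, hΔd⟩ := hΔF
  have hlt : #Δ < n := by
    refine lt_of_le_of_ne hΔn fun heq => ?_
    have := exp_card_dissociated_le hβ0 hβ1 hT hM hβT hΔT hη (by rw [heq]; exact hηn) hΔd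
    rw [heq] at this
    linarith
  refine ⟨Δ, hΔn, fun γ hγ => ?_⟩
  by_cases hγΔ : γ ∈ Δ
  · refine ⟨-Pi.single γ 1, neg_mem_signs ?_, ?_⟩
    · rw [mem_signs]
      intro δ
      by_cases h : δ = γ
      · subst h; simp [hγΔ]
      · simp [h]
    · have : comb (Pi.single γ (1 : ℤ)) = γ := by
        rw [comb, sum_eq_single γ] <;> simp +contextual
      rw [comb_neg, this, add_neg_cancel]
      have h1 : coeff β 0 = 1 := by
        rw [coeff]
        simp only [AddChar.zero_apply, mul_one]
        exact_mod_cast congrArg (fun t : ℝ => (t : ℂ)) hβ1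
      rw [h1, norm_one]; exact hη1
  · by_contra! hcon
    have hin : insert γ Δ ∈ F := by
      simp only [hF, mem_filter, mem_univ, true_and]
      refine ⟨by rw [card_insert_of_notMem hγΔ]; omega, ?_, ?_⟩
      · intro δ hδ
        rcases mem_insert.1 hδ with rfl | hδ
        · exact hγ
        · exact hΔT δ hδ
      · intro e he hne
        rw [mem_signs] at he
        have hsplit : comb e = e γ • γ + comb (Function.update e γ 0) := by
          have h1 : comb (Function.update e γ 0) = ∑ δ ∈ univ.erase γ, e δ • δ := by
            rw [comb, ← add_sum_erase (univ : Finset (AddChar G ℂ)) _ (mem_univ γ)]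
            rw [Function.update_self, zero_zsmul, zero_add]
            refine sum_congr rfl fun δ hδ => ?_
            rw [Function.update_of_ne (ne_of_mem_erase hδ)]
          rw [h1, comb, ← add_sum_erase (univ : Finset (AddChar G ℂ)) _ (mem_univ γ)]
        have hupd : Function.update e γ 0 ∈ signs Δ := by
          rw [mem_signs]
          intro δ
          by_cases h : δ = γ
          · subst h; simp
          · rw [Function.update_of_ne h]
            have := he δ
            simpa [h] using this
        rcases (he γ).1 (mem_insert_self _ _) with h | h | h
        · have := hcon _ (neg_mem_signs hupd)
          rw [hsplit, h, ← norm_coeff_neg]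
          rw [comb_neg] at this
          rwa [neg_one_zsmul, neg_add, neg_neg]
        · have hee : Function.update e γ 0 = e := by rw [← h, Function.update_eq_self]
          rw [hee] at hupd
          exact hΔd e hupd hne
        · rw [hsplit, h, one_smul]
          exact hcon _ hupd
    have := hmax _ hin
    rw [card_insert_of_notMem hγΔ] at this
    omega

lemma norm_mul_sub_one_le {a b : ℂ} (hb : ‖b‖ = 1) : ‖a * b - 1‖ ≤ ‖a - 1‖ + ‖b - 1‖ := by
  have : a * b - 1 = (a - 1) * b + (b - 1) := by ring
  rw [this]
  refine (norm_add_le _ _).trans ?_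
  rw [norm_mul, hb, mul_one]

lemma norm_prod_sub_one_le' {ι : Type*} (s : Finset ι) (f : ι → ℂ) (hf : ∀ i, ‖f i‖ = 1) :
    ‖∏ i ∈ s, f i - 1‖ ≤ ∑ i ∈ s, ‖f i - 1‖ := by
  classical
  induction s using Finset.induction_on with
  | empty => simp
  | insert a s ha ih =>
    rw [prod_insert ha, sum_insert ha, mul_comm]
    refine (norm_mul_sub_one_le (hf a)).trans ?_
    linarith

lemma norm_comb_sub_one_le {Δ : Finset (AddChar G ℂ)} {e : AddChar G ℂ → ℤ} (he : e ∈ signs Δ)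
    {y : G} {σ : ℝ} (hy : ∀ δ ∈ Δ, ‖δ y - 1‖ ≤ σ) : ‖comb e y - 1‖ ≤ #Δ * σ := by
  have he' := mem_signs.1 he
  rw [comb_apply, ← prod_subset (subset_univ Δ)]
  · refine (norm_prod_sub_one_le' Δ (fun γ => γ y ^ e γ) fun γ => ?_).trans ?_
    · rw [norm_zpow, AddChar.norm_apply, one_zpow]
    · rw [← nsmul_eq_mul]
      refine sum_le_card_nsmul _ _ _ fun δ hδ => ?_
      have h0 := hy δ hδ
      rcases (he' δ).1 hδ with h | h | h
      · rw [h, zpow_neg_one, ← AddChar.map_neg_eq_inv, norm_char_neg_sub_one]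
        exact h0
      · rw [h]; simp; exact (norm_nonneg _).trans h0
      · rw [h, zpow_one]; exact h0
  · intro γ _ hγ
    rw [(he' γ).2 hγ, zpow_zero]

/-- The average of `f` over the shifts by `-z` with `z ∈ Z`. -/
noncomputable def avg (Z : Finset G) (f : G → ℝ) (x : G) : ℝ := (∑ z ∈ Z, f (x - z)) / #Z

lemma coeff_avg (Z : Finset G) (f : G → ℝ) (γ : AddChar G ℂ) :
    coeff (avg Z f) γ = charMean Z γ * coeff f γ := by
  simp only [coeff, avg, charMean]
  push_cast
  rw [div_mul_eq_mul_div, sum_mul_sum, sum_div]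
  simp only [div_mul_eq_mul_div, sum_mul, ← sum_div]
  congr 1
  rw [sum_comm]
  refine sum_congr rfl fun z _ => ?_
  rw [← Equiv.sum_comp (Equiv.addRight z)]
  refine sum_congr rfl fun x _ => ?_
  simp only [Equiv.coe_addRight, add_sub_cancel_right, AddChar.map_add_eq_mul]
  ring

lemma coeff_avg_iterate (Z : Finset G) (f : G → ℝ) (γ : AddChar G ℂ) (L : ℕ) :
    coeff ((avg Z)^[L] f) γ = charMean Z γ ^ L * coeff f γ := by
  induction L with
  | zero => simp
  | succ L ih => rw [Function.iterate_succ_apply', coeff_avg, ih, pow_succ]; ring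

lemma avg_nonneg {Z : Finset G} {f : G → ℝ} (hf : ∀ x, 0 ≤ f x) (x : G) : 0 ≤ avg Z f x :=
  div_nonneg (sum_nonneg fun _ _ => hf _) (Nat.cast_nonneg _)

lemma avg_iterate_nonneg {Z : Finset G} {f : G → ℝ} (hf : ∀ x, 0 ≤ f x) (L : ℕ) (x : G) :
    0 ≤ (avg Z)^[L] f x := by
  induction L generalizing x with
  | zero => exact hf x
  | succ L ih => rw [Function.iterate_succ_apply']; exact avg_nonneg ih x

lemma le_avg_iterate {Z : Finset G} (hZ : Z.Nonempty) {X : ℕ → Finset G}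
    (hX : ∀ i, ∀ x ∈ X i, ∀ z ∈ Z, x - z ∈ X (i + 1)) {v : ℝ} (i : ℕ)
    (f : G → ℝ) (h : ∀ z ∈ X i, v ≤ f z) {z : G} (hz : z ∈ X 0) : v ≤ (avg Z)^[i] f z := by
  induction i generalizing f with
  | zero => exact h z hz
  | succ i ih =>
    rw [Function.iterate_succ_apply]
    refine ih _ fun x hx => ?_
    rw [avg, le_div_iff₀ (by exact_mod_cast hZ.card_pos), mul_comm, ← nsmul_eq_mul]
    exact card_nsmul_le_sum _ _ _ fun z hz => h _ (hX i x hx z hz)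

lemma coeff_zero (β : G → ℝ) : coeff β 0 = ((∑ x, β x : ℝ) : ℂ) := by
  simp [coeff]

lemma norm_sub_one_le_of_charMean {Γ : Finset (AddChar G ℂ)} {κ s : ℝ} {q : ℕ}
    (hs : 0 ≤ s) (hκ : 0 ≤ κ) (hreg : IsRegular Γ κ q s) {ψ : AddChar G ℂ}
    (hψ : 1 / 2 ≤ ‖charMean (bohr Γ s) ψ‖) {y : G} (hy : y ∈ bohr Γ (κ * s)) :
    ‖ψ y - 1‖ ≤ 4 / q := by
  classical
  have hc : (0 : ℝ) < #(bohr Γ s) := by exact_mod_cast card_bohr_pos hs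
  have h1 := norm_sum_shift_sub_le (B := bohr Γ s) (B' := bohr Γ (s + κ * s)) (δ := 1 / q)
    (bohr_mono (by nlinarith)) (y := y) (fun x hx => add_mem_bohr hx hy le_rfl) hreg
    (fun x => ψ x) (fun x => (AddChar.norm_apply ψ x).le)
  have h2 : ∑ x ∈ bohr Γ s, ψ (x + y) - ∑ x ∈ bohr Γ s, ψ x =
      charMean (bohr Γ s) ψ * #(bohr Γ s) * (ψ y - 1) := by
    rw [charMean, div_mul_cancel₀ _ (by exact_mod_cast hc.ne')]
    simp only [AddChar.map_add_eq_mul, ← sum_mul]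
    ring
  rw [h2, norm_mul, norm_mul, Complex.norm_natCast] at h1
  have h3 : ‖charMean (bohr Γ s) ψ‖ * ‖ψ y - 1‖ ≤ 2 * (1 / q) := by
    refine le_of_mul_le_mul_right ?_ hc
    linarith
  have h4 := norm_nonneg (ψ y - 1)
  have h5 : (4 : ℝ) / q = 4 * (1 / q) := by ring
  rw [h5]
  nlinarith

lemma exists_bohr_norm_sub_one_le {Γ : Finset (AddChar G ℂ)} {κ ρ s : ℝ} {q n : ℕ}
    (hs : 0 ≤ s) (hκ : 0 ≤ κ) (hreg : IsRegular Γ κ q s) {T : Finset G} (hT : T.Nonempty)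
    (hTB : T ⊆ bohr Γ ρ) (hρ : 0 ≤ ρ) (hn1 : 1 ≤ n)
    (hn : 2 * ((#(bohr Γ (ρ + n * s)) : ℝ) / #T) < Real.exp (n / 8)) :
    ∃ Δ : Finset (AddChar G ℂ), #Δ ≤ n ∧ ∀ γ, 1 / 2 ≤ ‖charMean T γ‖ →
      ∀ σ, 0 ≤ σ → ∀ y ∈ bohr Γ (κ * s), y ∈ bohr Δ σ → ‖γ y - 1‖ ≤ 4 / q + n * σ := by
  classical
  set Y := bohr Γ (ρ + n * s) with hY
  set Z := bohr Γ s with hZ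
  have hTc : (0 : ℝ) < #T := by exact_mod_cast hT.card_pos
  have hYc : (0 : ℝ) < #Y := by exact_mod_cast card_bohr_pos (by positivity)
  have hZc : Z.Nonempty := card_pos.1 (card_bohr_pos hs)
  set f : G → ℝ := fun x => if x ∈ Y then 1 / (#Y : ℝ) else 0 with hf
  have hf0 : ∀ x, 0 ≤ f x := fun x => by simp only [hf]; split_ifs <;> positivity
  have hfsum : ∑ x, f x = 1 := by
    simp only [hf, sum_ite_mem, univ_inter, sum_const, nsmul_eq_mul]
    field_simp
  set β := (avg Z)^[n] f with hβ
  have hβ1 : ∑ x, β x = 1 := by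
    have h1 := coeff_avg_iterate Z f 0 n
    have h2 : charMean Z (0 : AddChar G ℂ) = 1 := by
      have : (#Z : ℂ) ≠ 0 := by exact_mod_cast hZc.card_pos.ne'
      simp [charMean, this]
    rw [h2, coeff_zero, coeff_zero, hfsum] at h1
    have h3 : ((∑ x, (avg Z)^[n] f x : ℝ) : ℂ) = ((1 : ℝ) : ℂ) := by rw [h1]; simp
    exact_mod_cast h3
  have hβT : ∀ x ∈ T, 1 ≤ (#Y : ℝ) / #T * #T * β x := by
    intro x hx
    rw [div_mul_cancel₀ _ hTc.ne']
    have h1 : 1 / (#Y : ℝ) ≤ β x := by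
      refine le_avg_iterate hZc (X := fun i => bohr Γ (ρ + i * s)) ?_ n f ?_ ?_
      · intro i x hx z hz
        refine sub_mem_bohr hx hz ?_
        push_cast; linarith
      · intro z hz
        simp only [hf]
        rw [if_pos hz]
      · simpa using hTB hx
    rw [div_le_iff₀ hYc] at h1
    linarith
  have hηn : (1 / 2 : ℝ) ^ n * Real.exp (n / 2) ≤ 1 := by
    have : Real.exp (n / 2) = Real.exp (1 / 2) ^ n := by rw [← Real.exp_nat_mul]; ring_nf
    rw [this, ← mul_pow]
    refine pow_le_one₀ (by positivity) ?_
    have h2 : Real.exp (1 / 2) ^ 2 = Real.exp 1 := by rw [← Real.exp_nat_mul]; norm_num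
    have h3 := Real.exp_one_lt_d9
    have h4 := Real.exp_pos (1 / 2)
    nlinarith
  obtain ⟨Δ, hΔ, h⟩ := exists_comb_coeff (avg_iterate_nonneg hf0 n) hβ1 hT
    (by positivity : 0 ≤ (#Y : ℝ) / #T) hβT (η := (1 / 2) ^ n) (by positivity)
    (pow_lt_one₀ (by norm_num) (by norm_num) (by omega)) hηn hn
  refine ⟨Δ, hΔ, fun γ hγ σ hσ0 y hy hyΔ => ?_⟩
  obtain ⟨e, he, hlt⟩ := h γ hγ
  rw [coeff_avg_iterate, norm_mul, norm_pow] at hlt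
  have hcf : ‖coeff f (γ + comb e)‖ ≤ 1 := by
    refine (norm_sum_le _ _).trans ?_
    rw [← hfsum]
    refine sum_le_sum fun x _ => ?_
    rw [norm_mul, AddChar.norm_apply, mul_one, Complex.norm_real, Real.norm_of_nonneg (hf0 x)]
  have hψ : 1 / 2 ≤ ‖charMean Z (γ + comb e)‖ := by
    by_contra! hcon
    have h1 : ‖charMean Z (γ + comb e)‖ ^ n ≤ (1 / 2) ^ n :=
      pow_le_pow_left₀ (norm_nonneg _) hcon.le n
    have h2 : 0 ≤ ‖charMean Z (γ + comb e)‖ ^ n := by positivity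
    nlinarith
  have h1 := norm_sub_one_le_of_charMean hs hκ hreg hψ hy
  have hσ : ∀ δ ∈ Δ, ‖δ y - 1‖ ≤ σ := mem_bohr.1 hyΔ
  have h2 := norm_comb_sub_one_le (neg_mem_signs he) hσ
  have h3 : γ y = (γ + comb e) y * comb (-e) y := by
    rw [comb_neg, ← AddChar.add_apply, add_neg_cancel_right]
  rw [h3]
  refine (norm_mul_sub_one_le (AddChar.norm_apply _ _)).trans (add_le_add h1 (h2.trans ?_))
  have : (#Δ : ℝ) ≤ n := by exact_mod_cast hΔ
  exact mul_le_mul_of_nonneg_right this hσ0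

end Chang

section Pair
variable {G : Type*} [AddCommGroup G] [Fintype G] [DecidableEq G]

/-- The density of `A` on the translate `x + W`. -/
noncomputable def dens (A W : Finset G) (x : G) : ℝ := (∑ w ∈ W, ind A (x + w)) / #W

lemma dens_nonneg (A W : Finset G) (x : G) : 0 ≤ dens A W x :=
  div_nonneg (sum_nonneg fun _ _ => ind_nonneg _ _) (Nat.cast_nonneg _)

lemma dens_le_one (A W : Finset G) (x : G) : dens A W x ≤ 1 := by
  refine div_le_one_of_le₀ ((sum_le_sum fun _ _ => ind_le_one _ _).trans ?_) (Nat.cast_nonneg _)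
  simp

lemma sum_ind (A : Finset G) : ∑ x, ind A x = #A := by
  simp [ind]

lemma sum_dens (A : Finset G) {W : Finset G} (hW : W.Nonempty) : ∑ x, dens A W x = #A := by
  have hc : (#W : ℝ) ≠ 0 := by exact_mod_cast hW.card_pos.ne'
  simp only [dens]
  rw [← sum_div, sum_comm, div_eq_iff hc]
  have h : ∀ w, ∑ x, ind A (x + w) = #A := fun w => by
    rw [← sum_ind A, ← Equiv.sum_comp (Equiv.addRight w) (ind A)]; rfl
  simp [h, mul_comm]

lemma sum_ind_mul (A : Finset G) (f : G → ℝ) : ∑ x, ind A x * f x = ∑ a ∈ A, f a := by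
  simp [ind]

lemma smooth_selfConv {A W : Finset G} (hW : ∀ w ∈ W, -w ∈ W) (z : G) :
    smooth W (selfConv A) z = (∑ x, dens A W x * dens A W (z - x)) / #A := by
  have h1 : ∀ u : G × G, selfConv A (z + (u.1 - u.2)) =
      (∑ x, ind A (x + u.1) * ind A (z - x - u.2)) / #A := by
    intro u
    rw [selfConv, ← sum_ind_mul A (fun a => ind A (z + (u.1 - u.2) - a)),
      ← Equiv.sum_comp (Equiv.addRight u.1)]
    congr 1
    refine sum_congr rfl fun x _ => ?_
    simp only [Equiv.coe_addRight]
    congr 2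
    abel
  have h2 : ∀ x, ∑ w ∈ W, ind A (x - w) = ∑ w ∈ W, ind A (x + w) := by
    intro x
    refine sum_nbij' (fun w => -w) (fun w => -w) hW hW ?_ ?_ ?_ <;> simp [sub_eq_add_neg]
  simp only [smooth, h1]
  rw [← sum_div, div_right_comm]
  congr 1
  rw [sum_comm, sum_div]
  refine sum_congr rfl fun x _ => ?_
  rw [sum_product, dens, dens, ← h2 (z - x), div_mul_div_comm, sum_mul_sum, card_product]
  push_cast
  rfl

lemma smooth_selfConv_le {A W : Finset G} (hA : A.Nonempty) (hWne : W.Nonempty)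
    (hW : ∀ w ∈ W, -w ∈ W) {M : ℝ} (h : ∀ x, dens A W x ≤ M) (z : G) :
    smooth W (selfConv A) z ≤ M := by
  have hc : (0 : ℝ) < #A := by exact_mod_cast hA.card_pos
  rw [smooth_selfConv hW, div_le_iff₀ hc, ← sum_dens A hWne, mul_sum]
  refine sum_le_sum fun x _ => ?_
  rw [mul_comm]
  exact mul_le_mul_of_nonneg_right (h _) (dens_nonneg _ _ _)

lemma le_smooth_selfConv {A W B : Finset G} (hA : A.Nonempty) (hWne : W.Nonempty)
    (hW : ∀ w ∈ W, -w ∈ W) {M : ℝ} (h : ∀ x, dens A W x ≤ M) {z : G}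
    (hB : ∀ a ∈ A, ∀ w ∈ W, a + w ∈ B) (hB' : ∀ a ∈ A, ∀ w ∈ W, z - a + w ∈ B) :
    M * (1 - (M * #B - #A) / #A) ≤ smooth W (selfConv A) z := by
  have hc : (0 : ℝ) < #A := by exact_mod_cast hA.card_pos
  have hM : 0 ≤ M := (dens_nonneg _ _ 0).trans (h 0)
  have hz : ∀ x, (∀ w ∈ W, x + w ∉ A) → dens A W x = 0 := by
    intro x hx
    rw [dens, sum_eq_zero, zero_div]
    intro w hw
    rw [ind, if_neg (hx w hw)]
  have hs1 : ∀ x ∉ B, dens A W x = 0 := by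
    intro x hx
    refine hz x fun w hw hmem => hx ?_
    have := hB _ hmem _ (hW w hw)
    rwa [add_neg_cancel_right] at this
  have hs2 : ∀ x ∉ B, dens A W (z - x) = 0 := by
    intro x hx
    refine hz _ fun w hw hmem => hx ?_
    have := hB' _ hmem _ hw
    rwa [show z - (z - x + w) + w = x by abel] at this
  have hsum1 : ∑ x ∈ B, dens A W x = #A := by
    rw [← sum_dens A hWne]
    exact sum_subset (subset_univ _) fun x _ hx => hs1 x hx
  have hsum2 : ∑ x ∈ B, dens A W (z - x) = #A := by
    rw [← sum_dens A hWne, ← Equiv.sum_comp (Equiv.subLeft z) (dens A W)]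
    exact sum_subset (subset_univ _) fun x _ hx => hs2 x hx
  rw [smooth_selfConv hW, le_div_iff₀ hc]
  have h1 : ∑ x ∈ B, dens A W x * dens A W (z - x) = ∑ x, dens A W x * dens A W (z - x) :=
    sum_subset (subset_univ _) fun x _ hx => by rw [hs1 x hx, zero_mul]
  rw [← h1]
  have h2 : ∑ x ∈ B, dens A W x * (M - dens A W (z - x)) ≤
      ∑ x ∈ B, M * (M - dens A W (z - x)) :=
    sum_le_sum fun x _ => mul_le_mul_of_nonneg_right (h x) (sub_nonneg.2 (h _))
  rw [← mul_sum, sum_sub_distrib, hsum2, sum_const, nsmul_eq_mul] at h2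
  simp only [mul_sub] at h2
  rw [sum_sub_distrib, ← sum_mul, hsum1] at h2
  have h3 : M * (1 - (M * #B - #A) / #A) * #A = M * (2 * #A - M * #B) := by
    field_simp; ring
  rw [h3]
  linarith

lemma two_pow_lt_exp (a : ℕ) {n : ℕ} (hn : 8 * (a + 1) ≤ n) :
    (2 : ℝ) ^ a < Real.exp (n / 8) := by
  have h1 : (2 : ℝ) ^ a ≤ Real.exp 1 ^ a :=
    pow_le_pow_left₀ (by norm_num) (by linarith [Real.add_one_le_exp 1]) _
  refine h1.trans_lt ?_
  rw [← Real.exp_nat_mul, Real.exp_lt_exp]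
  have : (8 * (a + 1) : ℝ) ≤ n := by exact_mod_cast hn
  linarith

lemma exists_smoothing {A Bp : Finset G} {Γ : Finset (AddChar G ℂ)} (hA : A.Nonempty)
    {p l m k n q : ℕ} {α Q κ r₃ r₄ ρ ρ' : ℝ}
    (hm : 1 ≤ m) (hp : 1 ≤ α * 2 ^ p) (hl : 2048 ≤ α * 4 ^ l) (hq : 20480 ≤ α * q)
    (hl1 : 1 ≤ l) (hQ : 16 * 192 * l ^ 2 * 1024 ^ 2 ≤ Q) (hk : Q * m * 2 ^ p ≤ k)
    (hn : 8 * (k * (p + 2) + 4) ≤ n) (hκ : 0 ≤ κ)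
    (hr₃ : 0 ≤ r₃) (hr₄ : 0 ≤ r₄) (hρ : 0 ≤ ρ)
    (hAS : ∀ a ∈ A, ∀ s ∈ bohr Γ r₃, a - s ∈ Bp) (hBp : (#Bp : ℝ) ≤ 2 ^ (p + 2) * #A)
    (h₃ : IsRegular Γ κ q r₃) (h₄ : IsRegular Γ κ q r₄) (h₃₄ : n * r₄ ≤ κ * r₃)
    (hρρ' : ρ + l * (2 * r₃) ≤ ρ') :
    ∃ T ⊆ bohr Γ r₃, T.Nonempty ∧ ∃ Δ : Finset (AddChar G ℂ), #Δ ≤ n ∧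
      ∀ W ⊆ bohr Γ (κ * r₄), W.Nonempty → W ⊆ bohr Δ (1 / (q * n)) →
        ∑ z ∈ bohr Γ ρ,
          (smooth W ((smooth T)^[l] (selfConv A)) z - selfConv A z) ^ (2 * m) ≤
        (1 / 1024) ^ (2 * m) * (2 * α ^ (2 * m) * #(bohr Γ ρ') +
          ∑ z ∈ bohr Γ ρ', selfConv A z ^ (2 * m)) := by
  have hα : 0 < α := by
    have : (0 : ℝ) < 2 ^ p := by positivity
    nlinarith
  have hl' : (1 : ℝ) ≤ l := by exact_mod_cast hl1
  have hl2 : (1 : ℝ) ≤ (l : ℝ) ^ 2 := one_le_pow₀ hl'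
  have hQ1 : 1 ≤ Q := by linarith
  have hQ0 : 0 < Q := by linarith
  have hn0 : (0 : ℝ) < n := by
    have : 0 < n := by omega
    exact_mod_cast this
  have hq0 : (0 : ℝ) < q := by
    by_contra! hcon
    have : α * q ≤ 0 := mul_nonpos_of_nonneg_of_nonpos hα.le hcon
    linarith
  have hq1 : (1 : ℝ) ≤ q := by
    have : 0 < q := by exact_mod_cast hq0
    exact_mod_cast this
  have hρ' : ρ ≤ ρ' := by nlinarith
  have hk' : Q * m ≤ k * α := by
    have h1 : 0 ≤ Q * m := by positivity
    calc Q * m = Q * m * 1 := (mul_one _).symm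
      _ ≤ Q * m * (α * 2 ^ p) := by gcongr
      _ = Q * m * 2 ^ p * α := by ring
      _ ≤ k * α := by gcongr
  obtain ⟨T, hTS, hTcard, hT⟩ := exists_almostPeriods (S := bohr Γ r₃) (X := bohr Γ ρ') hA
    (card_pos.1 (card_bohr_pos (hρ.trans hρ'))) hAS hm hα hQ1 hk'
  have hAc : (0 : ℝ) < #A := by exact_mod_cast hA.card_pos
  have hSc : (0 : ℝ) < #(bohr Γ r₃) := by exact_mod_cast card_bohr_pos hr₃
  have hT2 : (#(bohr Γ r₃) : ℝ) ≤ 2 * #T * (2 ^ (p + 2)) ^ k := by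
    have h1 : (#Bp : ℝ) ^ k ≤ (2 ^ (p + 2) * #A) ^ k := by gcongr
    rw [mul_pow] at h1
    have h2 : (#(bohr Γ r₃) : ℝ) * #A ^ k ≤ 2 * #T * (2 ^ (p + 2)) ^ k * #A ^ k := by
      refine hTcard.trans ?_
      calc 2 * ((#T : ℝ) * #Bp ^ k) ≤ 2 * (#T * ((2 ^ (p + 2)) ^ k * #A ^ k)) := by gcongr
        _ = _ := by ring
    exact le_of_mul_le_mul_right h2 (by positivity)
  have hTne : T.Nonempty := by
    rw [nonempty_iff_ne_empty]
    rintro rfl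
    rw [card_empty, Nat.cast_zero, mul_zero, zero_mul] at hT2
    linarith
  have hTc : (0 : ℝ) < #T := by exact_mod_cast hTne.card_pos
  have hY : (#(bohr Γ (r₃ + n * r₄)) : ℝ) ≤ 2 * #(bohr Γ r₃) := by
    have h1 : (#(bohr Γ (r₃ + n * r₄)) : ℝ) ≤ #(bohr Γ (r₃ + κ * r₃)) := by
      exact_mod_cast card_le_card (bohr_mono (by linarith))
    refine h1.trans (h₃.trans ?_)
    gcongr
    have : (1 : ℝ) / q ≤ 1 := by rw [div_le_one hq0]; exact hq1
    linarith
  obtain ⟨Δ, hΔ, hspec⟩ := exists_bohr_norm_sub_one_le hr₄ hκ h₄ hTne hTS hr₃ (by omega : 1 ≤ n)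
    (by
      refine lt_of_le_of_lt ?_ (two_pow_lt_exp (k * (p + 2) + 3) (by omega))
      rw [← mul_div_assoc, div_le_iff₀ hTc]
      calc 2 * (#(bohr Γ (r₃ + n * r₄)) : ℝ) ≤ 2 * (2 * (2 * #T * (2 ^ (p + 2)) ^ k)) := by
            linarith
        _ = _ := by rw [← pow_mul, pow_add 2 (k * (p + 2)), mul_comm (p + 2) k]; ring)
  refine ⟨T, hTS, hTne, Δ, hΔ, fun W hW hWne hWΔ => ?_⟩
  set F := selfConv A with hF
  set F₁ := (smooth T)^[l] F with hF₁
  have hfour : ∀ z, |smooth W F₁ z - F₁ z| ≤ α / 2048 := by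
    refine abs_smooth_smooth_iterate_sub_le hA fun γ => ?_
    have hW1 := norm_charMean_le_one W γ
    have hT1 := norm_charMean_le_one T γ
    have hT0 := norm_nonneg (charMean T γ)
    have hW0 : 0 ≤ 1 - ‖charMean W γ‖ ^ 2 := by
      have := norm_nonneg (charMean W γ)
      nlinarith
    rcases lt_or_ge ‖charMean T γ‖ (1 / 2) with h | h
    · have h1 : ‖charMean T γ‖ ^ (2 * l) ≤ (1 / 2) ^ (2 * l) := by gcongr
      have h2 : ((1 : ℝ) / 2) ^ (2 * l) * 4 ^ l = 1 := by
        rw [pow_mul, ← mul_pow]; norm_num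
      have h3 : (0 : ℝ) < 4 ^ l := by positivity
      have h4 : ((1 : ℝ) / 2) ^ (2 * l) ≤ α / 2048 := by
        refine le_of_mul_le_mul_right ?_ h3
        rw [h2]; linarith
      have h5 : 1 - ‖charMean W γ‖ ^ 2 ≤ 1 := by linarith [sq_nonneg ‖charMean W γ‖]
      have h6 := mul_le_mul (h1.trans h4) h5 hW0 (by positivity)
      rwa [mul_one] at h6
    · have h1 : 1 - ‖charMean W γ‖ ^ 2 ≤ 2 * (5 / q) := by
        refine one_sub_norm_charMean_sq_le hWne fun w hw => ?_
        have h2 := hspec γ h (1 / (q * n)) (by positivity) w (hW hw) (hWΔ hw)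
        have h3 : (n : ℝ) * (1 / (q * n)) = 1 / q := by field_simp
        rw [h3, ← add_div] at h2
        norm_num at h2 ⊢
        exact h2
      have h2 : ‖charMean T γ‖ ^ (2 * l) ≤ 1 := pow_le_one₀ hT0 hT1
      have h3 : 2 * (5 / (q : ℝ)) ≤ α / 2048 := by
        rw [← mul_div_assoc, div_le_iff₀ hq0]; linarith
      have h6 := mul_le_mul h2 (h1.trans h3) hW0 zero_le_one
      rwa [one_mul] at h6
  have heven : Even (2 * m) := even_two_mul m
  set P : ℝ := ∑ w ∈ bohr Γ ρ', (α ^ (2 * m) + F w ^ (2 * m)) with hP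
  have hP0 : 0 ≤ P := sum_nonneg fun w _ => by
    have := heven.pow_nonneg (F w); positivity
  have hper : ∑ z ∈ bohr Γ ρ, (F₁ z - F z) ^ (2 * m) ≤
      (l : ℝ) ^ (2 * m) * (16 * (48 / Q) ^ m * P) := by
    have hchain : ∀ i : ℕ, ∀ x ∈ bohr Γ (ρ + i * (2 * r₃)), ∀ t ∈ T, ∀ t' ∈ T,
        x + (t - t') ∈ bohr Γ (ρ + ((i + 1 : ℕ) : ℝ) * (2 * r₃)) := by
      intro i x hx t ht t' ht'
      refine add_mem_bohr hx (sub_mem_bohr (hTS ht) (hTS ht') le_rfl) ?_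
      push_cast; linarith
    have := sum_smooth_iterate_sub_pow_le (X := fun i : ℕ => bohr Γ (ρ + i * (2 * r₃))) hTne
      hchain hm F (l := l) (C := 16 * (48 / Q) ^ m * P) ?_
    · simpa using this
    · intro i hi
      have hi' : ((i + 1 : ℕ) : ℝ) ≤ l := by exact_mod_cast hi
      have hsub : bohr Γ (ρ + ((i + 1 : ℕ) : ℝ) * (2 * r₃)) ⊆ bohr Γ ρ' :=
        bohr_mono (by nlinarith)
      refine sum_smooth_sub_pow_le hTne F hm fun t ht t' ht' => ?_
      refine hT t' ht' t ht _ ((bohr_mono ?_).trans hsub) fun w hw => hsub (hchain i w hw t ht t' ht')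
      push_cast; linarith
  have hfin : ∀ z, (smooth W F₁ z - F z) ^ (2 * m) ≤
      4 ^ m * ((α / 2048) ^ (2 * m) + (F₁ z - F z) ^ (2 * m)) := by
    intro z
    have h1 := add_pow_two_mul_le (smooth W F₁ z - F₁ z) (F₁ z - F z) m
    rw [sub_add_sub_cancel] at h1
    refine h1.trans ?_
    have h2 : (smooth W F₁ z - F₁ z) ^ (2 * m) ≤ (α / 2048) ^ (2 * m) := by
      rw [← heven.pow_abs]
      exact pow_le_pow_left₀ (abs_nonneg _) (hfour z) _
    exact mul_le_mul_of_nonneg_left (add_le_add_left h2 _) (by positivity)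
  refine (sum_le_sum fun z _ => hfin z).trans ?_
  rw [← mul_sum, sum_add_distrib, sum_const, nsmul_eq_mul]
  have hc1 : (4 : ℝ) ^ m * (α / 2048) ^ (2 * m) = (1 / 1024) ^ (2 * m) * α ^ (2 * m) := by
    rw [show (4 : ℝ) ^ m = 2 ^ (2 * m) by rw [pow_mul]; norm_num, ← mul_pow, ← mul_pow]
    congr 1; ring
  have hc2 : (4 : ℝ) ^ m * ((l : ℝ) ^ (2 * m) * (16 * (48 / Q) ^ m)) ≤ (1 / 1024) ^ (2 * m) := by
    have h1 : (4 : ℝ) ^ m * ((l : ℝ) ^ (2 * m) * (16 * (48 / Q) ^ m)) =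
        16 * (192 * l ^ 2 / Q) ^ m := by
      rw [pow_mul, div_pow, div_pow, mul_pow, show (192 : ℝ) = 4 * 48 by norm_num, mul_pow]
      ring
    have h2 : 192 * (l : ℝ) ^ 2 / Q ≤ 1 / 16 * (1 / 1024) ^ 2 := by
      rw [div_le_iff₀ hQ0]
      linarith
    have h3 : ((1 : ℝ) / 16) ^ m ≤ 1 / 16 := pow_le_of_le_one (by norm_num) (by norm_num) (by omega)
    rw [h1]
    calc 16 * (192 * (l : ℝ) ^ 2 / Q) ^ m ≤ 16 * (1 / 16 * (1 / 1024) ^ 2) ^ m := by gcongr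
      _ = 16 * ((1 / 16) ^ m * (1 / 1024) ^ (2 * m)) := by rw [mul_pow, pow_mul]
      _ ≤ 16 * (1 / 16 * (1 / 1024) ^ (2 * m)) := by gcongr
      _ = _ := by ring
  have hcard : (#(bohr Γ ρ) : ℝ) ≤ #(bohr Γ ρ') := by
    exact_mod_cast card_le_card (bohr_mono hρ')
  have hPe : P = #(bohr Γ ρ') * α ^ (2 * m) + ∑ z ∈ bohr Γ ρ', F z ^ (2 * m) := by
    rw [hP, sum_add_distrib, sum_const, nsmul_eq_mul]
  have hd : (0 : ℝ) ≤ (1 / 1024) ^ (2 * m) := by positivity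
  have ha : 0 ≤ α ^ (2 * m) := by positivity
  calc (4 : ℝ) ^ m * (#(bohr Γ ρ) * (α / 2048) ^ (2 * m) +
        ∑ z ∈ bohr Γ ρ, (F₁ z - F z) ^ (2 * m))
      ≤ 4 ^ m * (#(bohr Γ ρ') * (α / 2048) ^ (2 * m) +
        (l : ℝ) ^ (2 * m) * (16 * (48 / Q) ^ m * P)) := by gcongr
    _ = #(bohr Γ ρ') * (4 ^ m * (α / 2048) ^ (2 * m)) +
        4 ^ m * ((l : ℝ) ^ (2 * m) * (16 * (48 / Q) ^ m)) * P := by ring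
    _ ≤ #(bohr Γ ρ') * ((1 / 1024) ^ (2 * m) * α ^ (2 * m)) + (1 / 1024) ^ (2 * m) * P := by
        rw [hc1]; gcongr
    _ = _ := by rw [hPe]; ring

end Pair

section Approx
variable {G : Type*} [AddCommGroup G] [Fintype G] [DecidableEq G]

lemma exists_approx {A Bp : Finset G} {Γ : Finset (AddChar G ℂ)} (hA : A.Nonempty)
    {p l m k n q N : ℕ} {α Q κ r₃ r₄ ρ ρ' : ℝ}
    (hm : 1 ≤ m) (hp : 1 ≤ α * 2 ^ p) (hl : 2048 ≤ α * 4 ^ l) (hq : 20480 ≤ α * q)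
    (hl1 : 1 ≤ l) (hQ : 16 * 192 * l ^ 2 * 1024 ^ 2 ≤ Q) (hk : Q * m * 2 ^ p ≤ k)
    (hn : 8 * (k * (p + 2) + 4) ≤ n) (hκ : 0 < κ)
    (hN : 7 * q * (#Γ + n + 1) ≤ N) (hκN : 2 * κ * N ≤ 1)
    (hr₃ : 0 ≤ r₃) (hr₄ : 0 < r₄) (hr₄n : κ * r₄ ≤ 1 / (q * n)) (hρ : 0 ≤ ρ)
    (hAS : ∀ a ∈ A, ∀ s ∈ bohr Γ r₃, a - s ∈ Bp) (hBp : (#Bp : ℝ) ≤ 2 ^ (p + 2) * #A)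
    (h₃ : IsRegular Γ κ q r₃) (h₄ : IsRegular Γ κ q r₄) (h₃₄ : n * r₄ ≤ κ * r₃)
    (hρρ' : ρ + l * (2 * r₃) ≤ ρ')
    (hd : ∀ Γ' : Finset (AddChar G ℂ), #Γ' ≤ #Γ + n → ∀ w, κ * r₄ / 2 ≤ w → w ≤ κ * r₄ →
      IsRegular Γ' κ q w → ∀ x, dens A (bohr Γ' w) x ≤ 101 / 100 * α)
    (hAB : ∀ a ∈ A, ∀ w ∈ bohr Γ (κ * r₄), a + w ∈ Bp)
    (hAB' : ∀ z ∈ bohr Γ ρ', ∀ a ∈ A, ∀ w ∈ bohr Γ (κ * r₄), z - a + w ∈ Bp)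
    (hcard : 101 / 100 * α * #Bp ≤ 106 / 100 * #A) :
    ∃ F : G → ℝ, (∀ z, 0 ≤ F z) ∧ (∀ z, F z ≤ 2 * α) ∧ (∀ z ∈ bohr Γ ρ, 9 / 10 * α ≤ F z) ∧
      ∑ z ∈ bohr Γ ρ, (F z - selfConv A z) ^ (2 * m) ≤
        (1 / 1024) ^ (2 * m) * (2 * α ^ (2 * m) * #(bohr Γ ρ') +
          ∑ z ∈ bohr Γ ρ', selfConv A z ^ (2 * m)) := by
  have hα : 0 < α := by
    have : (0 : ℝ) < 2 ^ p := by positivity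
    nlinarith
  have hAc : (0 : ℝ) < #A := by exact_mod_cast hA.card_pos
  have hq1 : 1 ≤ q := by
    by_contra! hcon
    have : q = 0 := by omega
    rw [this] at hq
    norm_num at hq
  obtain ⟨T, hTS, hTne, Δ, hΔ, hsm⟩ := exists_smoothing hA hm hp hl hq hl1 hQ hk hn hκ.le hr₃
    hr₄.le hρ hAS hBp h₃ h₄ h₃₄ hρρ'
  have hcardΓ : #(Γ ∪ Δ) ≤ #Γ + n := (card_union_le _ _).trans (by omega)
  obtain ⟨w, hw1, hw2, hreg⟩ := exists_isRegular (Γ ∪ Δ) hq1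
    (le_trans (Nat.mul_le_mul_left _ (by omega)) hN) hκN (mul_pos hκ hr₄) hκ.le
  have hw0 : 0 ≤ w := le_trans (by positivity) hw1
  set W := bohr (Γ ∪ Δ) w with hWdef
  have hWΓ : W ⊆ bohr Γ (κ * r₄) := (bohr_anti subset_union_left).trans (bohr_mono hw2)
  have hWΔ : W ⊆ bohr Δ (1 / (q * n)) :=
    (bohr_anti subset_union_right).trans (bohr_mono (hw2.trans hr₄n))
  have hWne : W.Nonempty := card_pos.1 (card_bohr_pos hw0)
  have hWs : ∀ w ∈ W, -w ∈ W := fun w hw => neg_mem_bohr hw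
  have hdW := hd _ hcardΓ w hw1 hw2 hreg
  refine ⟨smooth W ((smooth T)^[l] (selfConv A)), ?_, ?_, ?_, hsm W hWΓ hWne hWΔ⟩
  · intro z
    have hX : ∀ i : ℕ, ∀ x ∈ (fun _ : ℕ => (univ : Finset G)) i, ∀ t ∈ T, ∀ t' ∈ T,
      x + (t - t') ∈ (fun _ : ℕ => (univ : Finset G)) (i + 1) := by simp
    exact le_smooth hWne fun t _ t' _ => le_smooth_iterate hTne hX l _
      (fun z _ => selfConv_nonneg A z) (mem_univ _)
  · intro z
    rw [smooth_iterate_comm]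
    refine smooth_iterate_le hTne l _ (fun z => ?_) z
    refine (smooth_selfConv_le hA hWne hWs hdW z).trans ?_
    linarith
  · intro z hz
    rw [smooth_iterate_comm]
    have hchain : ∀ i : ℕ, ∀ x ∈ bohr Γ (ρ + i * (2 * r₃)), ∀ t ∈ T, ∀ t' ∈ T,
        x + (t - t') ∈ bohr Γ (ρ + ((i + 1 : ℕ) : ℝ) * (2 * r₃)) := by
      intro i x hx t ht t' ht'
      refine add_mem_bohr hx (sub_mem_bohr (hTS ht) (hTS ht') le_rfl) ?_
      push_cast; linarith
    refine le_smooth_iterate (X := fun i : ℕ => bohr Γ (ρ + i * (2 * r₃))) hTne hchain l _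
      (fun y hy => ?_) (by simpa using hz)
    have hy' := bohr_mono hρρ' hy
    refine le_trans ?_ (le_smooth_selfConv (B := Bp) hA hWne hWs hdW
      (fun a ha w hw => hAB a ha w (hWΓ hw)) (fun a ha w hw => hAB' y hy' a ha w (hWΓ hw)))
    have h1 : (101 / 100 * α * #Bp - #A) / #A ≤ 6 / 100 := by
      rw [div_le_iff₀ hAc]; linarith
    have h2 : (94 : ℝ) / 100 ≤ 1 - (101 / 100 * α * #Bp - #A) / #A := by linarith
    have h3 : 101 / 100 * α * (94 / 100) ≤ 101 / 100 * α * (1 - (101 / 100 * α * #Bp - #A) / #A) :=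
      mul_le_mul_of_nonneg_left h2 (by positivity)
    linarith

lemma recursion_le {v : ℕ → ℝ} {J : ℕ} {a b ε : ℝ} (ha : 0 ≤ a) (hab : a ≤ b) (hε : 0 ≤ ε)
    (hε1 : ε ≤ 1 / 4) (hJ : v J ≤ 2) (hv : ∀ j < J, v j ≤ ε * (4 * a + v (j + 1)) + 2 * b)
    {i : ℕ} (hi : i ≤ J) : v (J - i) ≤ 4 * b + 2 * ε ^ i := by
  induction i with
  | zero => simp; linarith
  | succ i ih =>
    have h1 := hv (J - (i + 1)) (by omega)
    rw [show J - (i + 1) + 1 = J - i by omega] at h1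
    have h2 := ih (by omega)
    have h3 : ε * (4 * a + v (J - i)) ≤ ε * (4 * b + (4 * b + 2 * ε ^ i)) := by gcongr
    rw [pow_succ]
    have h4 : ε * b ≤ 1 / 4 * b := mul_le_mul_of_nonneg_right hε1 (ha.trans hab)
    linarith

lemma le_sum_of_chain {F : G → ℝ} (hF0 : ∀ z, 0 ≤ F z) (hF1 : ∀ z, F z ≤ 1) {X : ℕ → Finset G}
    {J m p : ℕ} {α : ℝ} (hα : 0 < α) (hm : p + 1 ≤ m) (hJ : p + 1 ≤ J) (hp : 1 ≤ α * 2 ^ p)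
    (hXJ : ∀ j ≤ J, (#(X j) : ℝ) ≤ 2 * #(X 0))
    (h : ∀ j < J, ∃ F' : G → ℝ, (∀ z, 0 ≤ F' z) ∧ (∀ z, F' z ≤ 2 * α) ∧
      (∀ z ∈ X j, 9 / 10 * α ≤ F' z) ∧
      ∑ z ∈ X j, (F' z - F z) ^ (2 * m) ≤
        (1 / 1024) ^ (2 * m) * (2 * α ^ (2 * m) * #(X (j + 1)) +
          ∑ z ∈ X (j + 1), F z ^ (2 * m)))
    {E : Finset G} (hE : E ⊆ X 0) (hEne : E.Nonempty) (hEc : α / 2 * #(X 0) ≤ #E) :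
    α / 2 ≤ (∑ z ∈ E, F z) / #E := by
  have hEc0 : (0 : ℝ) < #E := by exact_mod_cast hEne.card_pos
  have hX0 : (0 : ℝ) < #(X 0) := by exact_mod_cast (hEne.mono hE).card_pos
  have heven : Even (2 * m) := even_two_mul m
  have hm1 : 1 ≤ m := by omega
  have hfour : (4 : ℝ) ^ m = 2 ^ (2 * m) := by rw [pow_mul]; norm_num
  set v : ℕ → ℝ := fun j => (∑ z ∈ X j, F z ^ (2 * m)) / #(X 0) with hvdef
  have hsum : ∀ j, ∑ z ∈ X j, F z ^ (2 * m) = v j * #(X 0) := fun j => by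
    rw [hvdef]; field_simp
  have ha0 : 0 ≤ α ^ (2 * m) := by positivity
  have hd : (0 : ℝ) ≤ (1 / 1024) ^ (2 * m) := pow_nonneg (by norm_num) _
  have hrec : ∀ j < J, v j ≤
      (1 / 512) ^ (2 * m) * (4 * α ^ (2 * m) + v (j + 1)) + 2 * (4 * α) ^ (2 * m) := by
    intro j hj
    obtain ⟨F', hF'0, hF'2, -, hF'⟩ := h j hj
    have h1 : ∀ z, F z ^ (2 * m) ≤ 4 ^ m * ((F' z - F z) ^ (2 * m) + (2 * α) ^ (2 * m)) := by
      intro z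
      have h2 := add_pow_two_mul_le (F z - F' z) (F' z) m
      rw [sub_add_cancel, ← heven.neg_pow (F z - F' z), neg_sub] at h2
      have h3 : F' z ^ (2 * m) ≤ (2 * α) ^ (2 * m) := pow_le_pow_left₀ (hF'0 z) (hF'2 z) _
      exact h2.trans (mul_le_mul_of_nonneg_left (add_le_add_right h3 _) (by positivity))
    have h4 : ∑ z ∈ X j, F z ^ (2 * m) ≤
        ((1 / 512) ^ (2 * m) * (4 * α ^ (2 * m) + v (j + 1)) + 2 * (4 * α) ^ (2 * m)) * #(X 0) := by
      refine (sum_le_sum fun z _ => h1 z).trans ?_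
      rw [← mul_sum, sum_add_distrib, sum_const, nsmul_eq_mul]
      rw [hsum] at hF'
      have h5 := hXJ j hj.le
      have h6 := hXJ (j + 1) hj
      calc (4 : ℝ) ^ m * (∑ z ∈ X j, (F' z - F z) ^ (2 * m) + #(X j) * (2 * α) ^ (2 * m))
          ≤ 4 ^ m * ((1 / 1024) ^ (2 * m) * (2 * α ^ (2 * m) * (2 * #(X 0)) + v (j + 1) * #(X 0)) +
            2 * #(X 0) * (2 * α) ^ (2 * m)) := by
            refine mul_le_mul_of_nonneg_left (add_le_add (hF'.trans ?_) ?_) (by positivity)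
            · refine mul_le_mul_of_nonneg_left ?_ hd
              linarith [mul_le_mul_of_nonneg_left h6 (by positivity : 0 ≤ 2 * α ^ (2 * m))]
            · exact mul_le_mul_of_nonneg_right h5 (by positivity)
        _ = (2 ^ (2 * m) * (1 / 1024) ^ (2 * m)) * (4 * α ^ (2 * m) + v (j + 1)) * #(X 0) +
            2 * (2 ^ (2 * m) * (2 * α) ^ (2 * m)) * #(X 0) := by rw [hfour]; ring
        _ = _ := by
            rw [← mul_pow, ← mul_pow]
            ring_nf
    rw [hvdef]
    exact (div_le_iff₀ hX0).2 h4
  have hvJ : v J ≤ 2 := by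
    rw [hvdef]
    refine (div_le_iff₀ hX0).2 (le_trans ?_ (hXJ J le_rfl))
    have : ∑ z ∈ X J, F z ^ (2 * m) ≤ ∑ z ∈ X J, 1 :=
      sum_le_sum fun z _ => pow_le_one₀ (hF0 z) (hF1 z)
    simpa using this
  have hv1 := recursion_le ha0 (pow_le_pow_left₀ hα.le (by linarith : α ≤ 4 * α) (2 * m))
    (by positivity) (by
      calc ((1 : ℝ) / 512) ^ (2 * m) ≤ 1 / 512 :=
            pow_le_of_le_one (by norm_num) (by norm_num) (by omega)
        _ ≤ 1 / 4 := by norm_num) hvJ hrec (i := J - 1) (by omega)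
  rw [show J - (J - 1) = 1 by omega] at hv1
  have hεJ : (((1 : ℝ) / 512) ^ (2 * m)) ^ (J - 1) ≤ (4 * α) ^ (2 * m) := by
    rw [← pow_mul, mul_comm, pow_mul]
    refine pow_le_pow_left₀ (by positivity) ?_ _
    have h1 : ((1 : ℝ) / 512) ^ (J - 1) ≤ (1 / 2) ^ (J - 1) :=
      pow_le_pow_left₀ (by norm_num) (by norm_num) _
    have h2 : ((1 : ℝ) / 2) ^ (J - 1) ≤ (1 / 2) ^ p :=
      pow_le_pow_of_le_one (by norm_num) (by norm_num) (by omega)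
    have h3 : ((1 : ℝ) / 2) ^ p ≤ α := by
      rw [div_pow, one_pow, div_le_iff₀ (by positivity)]; exact hp
    linarith
  obtain ⟨F', -, -, hF'l, hF'⟩ := h 0 (by omega)
  rw [zero_add] at hF'
  have hmain : ∑ z ∈ X 0, (F' z - F z) ^ (2 * m) ≤ (α / 64) ^ (2 * m) * #(X 0) := by
    refine hF'.trans ?_
    rw [hsum]
    have h1 := hXJ 1 (by omega)
    have h2 : α ^ (2 * m) ≤ (4 * α) ^ (2 * m) := pow_le_pow_left₀ hα.le (by linarith) _
    have h3 : (16 : ℝ) ≤ 4 ^ (2 * m) := by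
      calc (16 : ℝ) = 4 ^ 2 := by norm_num
        _ ≤ _ := pow_le_pow_right₀ (by norm_num) (by omega)
    calc (1 / 1024) ^ (2 * m) * (2 * α ^ (2 * m) * (#(X 1) : ℝ) + v 1 * #(X 0))
        ≤ (1 / 1024) ^ (2 * m) * (2 * (4 * α) ^ (2 * m) * (2 * #(X 0)) +
          (6 * (4 * α) ^ (2 * m)) * #(X 0)) := by
          refine mul_le_mul_of_nonneg_left (add_le_add ?_ ?_) hd
          · exact mul_le_mul (by linarith) h1 (Nat.cast_nonneg _) (by positivity)
          · exact mul_le_mul_of_nonneg_right (by linarith) hX0.le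
      _ = (1 / 1024) ^ (2 * m) * (4 * α) ^ (2 * m) * 10 * #(X 0) := by ring
      _ ≤ (1 / 1024) ^ (2 * m) * (4 * α) ^ (2 * m) * 4 ^ (2 * m) * #(X 0) := by
          refine mul_le_mul_of_nonneg_right (mul_le_mul_of_nonneg_left (by linarith) ?_) hX0.le
          exact mul_nonneg hd (by positivity)
      _ = _ := by
          rw [← mul_pow, ← mul_pow]
          ring_nf
  have hmean := mean_pow_le E (fun z => F' z - F z) m hm1
  have hbound : ((∑ z ∈ E, (F' z - F z)) / #E) ^ (2 * m) ≤ (α / 16) ^ (2 * m) := by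
    refine hmean.trans ?_
    rw [div_le_iff₀ hEc0]
    refine (sum_le_sum_of_subset_of_nonneg hE fun z _ _ => heven.pow_nonneg _).trans ?_
    refine hmain.trans ?_
    have h1 : (α / 16) ^ (2 * m) = (α / 64) ^ (2 * m) * 16 ^ m := by
      rw [show (16 : ℝ) ^ m = 4 ^ (2 * m) by rw [pow_mul]; norm_num, ← mul_pow]
      congr 1; ring
    have h2 : (2 : ℝ) ≤ α * 16 ^ m := by
      have h3 : (2 : ℝ) ^ (p + 1) ≤ 16 ^ m :=
        (pow_le_pow_right₀ (by norm_num) hm).trans (pow_le_pow_left₀ (by norm_num) (by norm_num) _)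
      rw [pow_succ] at h3
      nlinarith
    rw [h1, mul_assoc]
    refine mul_le_mul_of_nonneg_left ?_ (by positivity)
    calc (#(X 0) : ℝ) = 2 / 2 * #(X 0) := by ring
      _ ≤ α * 16 ^ m / 2 * #(X 0) :=
          mul_le_mul_of_nonneg_right (div_le_div_of_nonneg_right h2 zero_le_two) hX0.le
      _ = 16 ^ m * (α / 2 * #(X 0)) := by ring
      _ ≤ _ := by gcongr
  rw [← heven.pow_abs] at hbound
  have habs := (abs_le.1 (le_of_pow_le_pow_left₀ (by omega) (by positivity) hbound)).2
  rw [sum_sub_distrib, sub_div] at habs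
  have hlow : 9 / 10 * α ≤ (∑ z ∈ E, F' z) / #E := by
    rw [le_div_iff₀ hEc0, mul_comm, ← nsmul_eq_mul]
    exact card_nsmul_le_sum _ _ _ fun z hz => hF'l z (hE hz)
  linarith

end Approx

section Step
variable {G : Type*} [AddCommGroup G] [Fintype G] [DecidableEq G]

/-- The part of a translate of `A` that lies in `W`. -/
def localPart (A W : Finset G) (x : G) : Finset G := W.filter fun w => x + w ∈ A

lemma card_localPart (A : Finset G) {W : Finset G} (hW : W.Nonempty) (x : G) :
    (#(localPart A W x) : ℝ) = dens A W x * #W := by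
  have hc : (#W : ℝ) ≠ 0 := by exact_mod_cast hW.card_pos.ne'
  rw [dens, div_mul_cancel₀ _ hc]
  simp [localPart, ind]

lemma dens_localPart_le (A V W : Finset G) (x z : G) :
    dens (localPart A V x) W z ≤ dens A W (x + z) := by
  unfold dens
  refine div_le_div_of_nonneg_right (sum_le_sum fun w _ => ?_) (Nat.cast_nonneg _)
  unfold ind
  split_ifs with h1 h2
  · exact le_rfl
  · exact absurd (by simpa [add_assoc] using (mem_filter.1 h1).2) h2
  · exact zero_le_one
  · exact le_rfl

lemma sum_dens_bohr_ge (A : Finset G) {Γ : Finset (AddChar G ℂ)} {κ r : ℝ} {q : ℕ}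
    (hκr : 0 ≤ κ * r) (hreg : IsRegular Γ κ q r) {W : Finset G}
    (hWne : W.Nonempty) (hW : W ⊆ bohr Γ (κ * r)) (x₀ : G) (hr : 0 ≤ r) :
    (dens A (bohr Γ r) x₀ - 2 / q) * #(bohr Γ r) ≤ ∑ y ∈ bohr Γ r, dens A W (x₀ + y) := by
  have hc : (0 : ℝ) < #W := by exact_mod_cast hWne.card_pos
  have hB : (#(bohr Γ r) : ℝ) ≠ 0 := by exact_mod_cast (card_bohr_pos hr).ne'
  have h1 : ∀ w ∈ W, (dens A (bohr Γ r) x₀ - 2 / q) * #(bohr Γ r) ≤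
      ∑ y ∈ bohr Γ r, ind A (x₀ + y + w) := by
    intro w hw
    have h2 := norm_sum_shift_sub_le (bohr_mono (by linarith : r ≤ r + κ * r))
      (fun y hy => add_mem_bohr hy (hW hw) le_rfl) hreg (fun z => ind A (x₀ + z))
      (fun z => by rw [Real.norm_of_nonneg (ind_nonneg _ _)]; exact ind_le_one _ _)
    rw [Real.norm_eq_abs] at h2
    have h3 := (abs_le.1 h2).1
    rw [sub_mul, dens, div_mul_cancel₀ _ hB]
    simp only [← add_assoc] at h3
    have h4 : (2 : ℝ) / q = 2 * (1 / q) := by ring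
    rw [h4]
    linarith
  simp only [dens] at h1 ⊢
  rw [← sum_div, sum_comm, le_div_iff₀ hc, mul_comm, ← nsmul_eq_mul]
  exact card_nsmul_le_sum _ _ _ h1

lemma exists_dens_ge (A : Finset G) {Γ : Finset (AddChar G ℂ)} {κ r α : ℝ} {q : ℕ}
    (hr : 0 ≤ r) (hκr : 0 ≤ κ * r) (hreg : IsRegular Γ κ q r) {W₁ W₂ : Finset G}
    (hne₁ : W₁.Nonempty) (h₁ : W₁ ⊆ bohr Γ (κ * r))
    (hne₂ : W₂.Nonempty) (h₂ : W₂ ⊆ bohr Γ (κ * r)) (hq : 400 ≤ α * q) {x₀ : G}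
    (hα : α ≤ dens A (bohr Γ r) x₀) (hu₁ : ∀ x, dens A W₁ x ≤ 101 / 100 * α)
    (hu₂ : ∀ x, dens A W₂ x ≤ 101 / 100 * α) :
    ∃ x, 98 / 100 * α ≤ dens A W₁ x ∧ 98 / 100 * α ≤ dens A W₂ x := by
  have hB : (0 : ℝ) < #(bohr Γ r) := by exact_mod_cast card_bohr_pos hr
  have hq0 : (0 : ℝ) < q := by
    rcases Nat.eq_zero_or_pos q with h | h
    · rw [h] at hq; norm_num at hq
    · exact_mod_cast h
  have hs₁ := sum_dens_bohr_ge A hκr hreg hne₁ h₁ x₀ hr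
  have hs₂ := sum_dens_bohr_ge A hκr hreg hne₂ h₂ x₀ hr
  have hqq : 2 / (q : ℝ) ≤ α / 200 := by
    rw [div_le_iff₀ hq0]; linarith
  obtain ⟨y, -, hy⟩ : ∃ y ∈ bohr Γ r,
      199 / 100 * α ≤ dens A W₁ (x₀ + y) + dens A W₂ (x₀ + y) := by
    by_contra! hcon
    have := sum_lt_sum_of_nonempty (card_pos.1 (card_bohr_pos hr)) hcon
    rw [sum_add_distrib, sum_const, nsmul_eq_mul] at this
    have h3 : (199 / 200 * α) * #(bohr Γ r) ≤
        (dens A (bohr Γ r) x₀ - 2 / q) * #(bohr Γ r) :=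
      mul_le_mul_of_nonneg_right (by linarith) hB.le
    linarith
  exact ⟨x₀ + y, by linarith [hu₂ (x₀ + y)], by linarith [hu₁ (x₀ + y)]⟩

lemma selfConv_localPart_le {A : Finset G}
    (hfree : ∀ a ∈ A, ∀ b ∈ A, ∀ c ∈ A, a + c = b + b → a = b) (W V : Finset G) (x : G) {y : G}
    (hy : y ∈ localPart A V x) :
    selfConv (localPart A W x) (y + y) ≤ 1 / #(localPart A W x) := by
  refine div_le_div_of_nonneg_right ?_ (Nat.cast_nonneg _)
  calc _ ≤ ∑ a ∈ localPart A W x, if a = y then (1 : ℝ) else 0 := by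
        refine sum_le_sum fun a ha => ?_
        unfold ind
        split_ifs with h1 h2
        · exact le_rfl
        · refine absurd ?_ h2
          have := hfree (x + a) (mem_filter.1 ha).2 (x + y) (mem_filter.1 hy).2
            (x + (y + y - a)) (mem_filter.1 h1).2 (by abel)
          exact add_left_cancel this
        · exact zero_le_one
        · exact le_rfl
    _ ≤ 1 := by
        rw [sum_ite_eq']
        split_ifs <;> norm_num

lemma exists_radii {half : G →+ G} {Γ : Finset (AddChar G ℂ)}
    {q N n l J : ℕ} {κ θ r : ℝ} (hq1 : 1 ≤ q) (hn0 : (1 : ℝ) ≤ n) (hl0 : (1 : ℝ) ≤ l)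
    (hJ0 : (1 : ℝ) ≤ J) (hN : 7 * q * (#Γ + 1) ≤ N) (hκ : 0 < κ) (hκ14 : 14 * κ ≤ 1)
    (hκN : 2 * κ * N ≤ 1) (hθ : θ * (512 * n * l * J) ≤ κ ^ 5) (hr : 0 < r) :
    ∃ r₁ r₂ r₃ r₄ g : ℝ, IsRegular Γ κ q r₁ ∧ IsRegular Γ κ q r₂ ∧ IsRegular (dil half Γ) κ q r₃ ∧
      IsRegular (dil half Γ) κ q r₄ ∧ 0 < r₂ ∧ 0 < r₃ ∧ 0 < r₄ ∧ 0 < g ∧ κ * r / 2 ≤ r₁ ∧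
      r₁ ≤ κ * r ∧ r₂ ≤ κ * r₁ / 8 ∧ J * g = κ * r₂ ∧ g ≤ κ * r₂ ∧ l * (2 * r₃) ≤ g ∧
      n * r₄ ≤ κ * r₃ ∧ 2 * r₃ ≤ g ∧ r₄ ≤ κ * r₃ ∧ κ * r₁ ≤ r₁ ∧ κ * r₂ ≤ r₂ ∧ κ * r₃ ≤ r₃ ∧
      κ * r₄ ≤ r₄ ∧ r₁ ≤ r ∧ θ * r ≤ κ * r₄ / 2 := by
  have hNd : ∀ Γ' : Finset (AddChar G ℂ), #Γ' ≤ #Γ → 7 * q * (#Γ' + 1) ≤ N := fun Γ' h =>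
    le_trans (Nat.mul_le_mul_left _ (by omega)) hN
  have hΓdc : #(dil half Γ) ≤ #Γ := card_dil_le
  have hκ1 : κ ≤ 1 := by linarith
  obtain ⟨r₁, hr₁l, hr₁u, hreg₁⟩ := exists_isRegular Γ hq1 (hNd _ le_rfl) hκN
    (mul_pos hκ hr) hκ.le
  have hr₁ : 0 < r₁ := lt_of_lt_of_le (by positivity) hr₁l
  obtain ⟨r₂, hr₂l, hr₂u, hreg₂⟩ := exists_isRegular Γ hq1 (hNd _ le_rfl) hκN
    (show 0 < κ * r₁ / 8 by positivity) hκ.le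
  have hr₂ : 0 < r₂ := lt_of_lt_of_le (by positivity) hr₂l
  obtain ⟨g, hg⟩ : ∃ g, g = κ * r₂ / J := ⟨_, rfl⟩
  have hg0 : 0 < g := by rw [hg]; positivity
  have hgJ : J * g = κ * r₂ := by rw [hg]; field_simp
  have hgle : g ≤ κ * r₂ := by rw [← hgJ]; exact le_mul_of_one_le_left hg0.le hJ0
  obtain ⟨r₃, hr₃l, hr₃u, hreg₃⟩ := exists_isRegular _ hq1 (hNd _ hΓdc) hκN
    (show 0 < g / (2 * l) by positivity) hκ.le
  have hr₃ : 0 < r₃ := lt_of_lt_of_le (by positivity) hr₃l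
  obtain ⟨r₄, hr₄l, hr₄u, hreg₄⟩ := exists_isRegular _ hq1 (hNd _ hΓdc) hκN
    (show 0 < κ * r₃ / n by positivity) hκ.le
  have hr₄ : 0 < r₄ := lt_of_lt_of_le (by positivity) hr₄l
  have hlr₃ : l * (2 * r₃) ≤ g := by
    rw [le_div_iff₀ (by positivity)] at hr₃u; linarith
  have hlr₃' : g ≤ 4 * l * r₃ := by
    rw [div_div, div_le_iff₀ (by positivity)] at hr₃l; linarith
  have hnr₄ : n * r₄ ≤ κ * r₃ := by
    rw [le_div_iff₀ (by positivity)] at hr₄u; linarith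
  have hnr₄' : κ * r₃ ≤ 2 * n * r₄ := by
    rw [div_div, div_le_iff₀ (by positivity)] at hr₄l; linarith
  have h2r₃ : 2 * r₃ ≤ g := le_trans (le_mul_of_one_le_left (by positivity) hl0) hlr₃
  have hr₄₃ : r₄ ≤ κ * r₃ := le_trans (le_mul_of_one_le_left hr₄.le hn0) hnr₄
  have hle : ∀ {s : ℝ}, 0 < s → κ * s ≤ s := fun hs => mul_le_of_le_one_left hs.le hκ1
  refine ⟨r₁, r₂, r₃, r₄, g, hreg₁, hreg₂, hreg₃, hreg₄, hr₂, hr₃, hr₄, hg0, hr₁l, hr₁u, hr₂u, hgJ,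
    hgle, hlr₃, hnr₄, h2r₃, hr₄₃, hle hr₁, hle hr₂, hle hr₃, hle hr₄, hr₁u.trans (hle hr), ?_⟩
  have e1 : κ ^ 4 * (κ * r) ≤ κ ^ 4 * (2 * r₁) :=
    mul_le_mul_of_nonneg_left (by linarith) (by positivity)
  have e2 : κ ^ 3 * (κ * r₁) ≤ κ ^ 3 * (16 * r₂) :=
    mul_le_mul_of_nonneg_left (by linarith) (by positivity)
  have e3 : κ ^ 2 * (κ * r₂) = κ ^ 2 * (J * g) := by rw [hgJ]
  have e4 : κ ^ 2 * (J * g) ≤ κ ^ 2 * (J * (4 * l * r₃)) := by gcongr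
  have e5 : κ * J * 4 * l * (κ * r₃) ≤ κ * J * 4 * l * (2 * n * r₄) := by gcongr
  have e6 : θ * (512 * n * l * J) * r ≤ κ ^ 5 * r := mul_le_mul_of_nonneg_right hθ hr.le
  refine le_of_mul_le_mul_left ?_ (show (0 : ℝ) < 512 * n * l * J by positivity)
  linarith

set_option maxHeartbeats 800000 in
lemma card_bohr_le_of_no_increment {half : G →+ G} (hh : ∀ x, half x + half x = x)
    {A : Finset G} (hfree : ∀ a ∈ A, ∀ b ∈ A, ∀ c ∈ A, a + c = b + b → a = b)
    {Γ : Finset (AddChar G ℂ)} {p l m J k n q N : ℕ} {α Q κ θ r : ℝ} {x₀ : G}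
    (hm : p + 1 ≤ m) (hJ : p + 1 ≤ J) (hp : 1 ≤ α * 2 ^ p) (hl : 2048 ≤ α * 4 ^ l)
    (hq : 20480 ≤ α * q) (hl1 : 1 ≤ l) (hQ : 16 * 192 * l ^ 2 * 1024 ^ 2 ≤ Q)
    (hk : Q * m * 2 ^ p ≤ k) (hn : 8 * (k * (p + 2) + 4) ≤ n) (hκ : 0 < κ)
    (hN : 7 * q * (#Γ + n + 1) ≤ N) (hκN : 2 * κ * N ≤ 1)
    (hθ : θ * (512 * n * l * J) ≤ κ ^ 5)
    (hr : 0 < r) (hr2 : r ≤ 2) (hreg : IsRegular Γ κ q r) (hdens : α ≤ dens A (bohr Γ r) x₀)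
    (H : ∀ Γ' : Finset (AddChar G ℂ), #Γ' ≤ #Γ + n → ∀ r', θ * r ≤ r' → r' ≤ r →
      IsRegular Γ' κ q r' → ∀ x, dens A (bohr Γ' r') x ≤ 101 / 100 * α) :
    (#(bohr Γ (κ * r / 2)) : ℝ) ≤ 4 * 4 ^ p := by
  have hα1 : α ≤ 1 := hdens.trans (dens_le_one _ _ _)
  have hα : 0 < α := by
    have : (0 : ℝ) < 2 ^ p := by positivity
    nlinarith
  have hq1 : 1 ≤ q := by
    by_contra! hcon
    have : q = 0 := by omega
    rw [this] at hq
    norm_num at hq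
  have hq1' : (1 : ℝ) ≤ q := by exact_mod_cast hq1
  have hqbig : (20480 : ℝ) ≤ q := by nlinarith
  have hn1 : 1 ≤ n := by omega
  have hn0 : (1 : ℝ) ≤ n := by exact_mod_cast hn1
  have hl0 : (1 : ℝ) ≤ l := by exact_mod_cast hl1
  have hJ0 : (1 : ℝ) ≤ J := by exact_mod_cast (by omega : 1 ≤ J)
  have hκq : 14 * (κ * q) ≤ 1 := by
    have h1 : 7 * q ≤ N := by nlinarith
    have h2 : (7 : ℝ) * q ≤ N := by exact_mod_cast h1
    nlinarith
  have hκ14 : 14 * κ ≤ 1 := by nlinarith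
  set Γd := dil half Γ with hΓd
  have hΓdc : #Γd ≤ #Γ := card_dil_le
  obtain ⟨r₁, r₂, r₃, r₄, g, hreg₁, hreg₂, hreg₃, hreg₄, hr₂, hr₃, hr₄, hg0, hr₁l, hr₁u, hr₂u, hgJ,
    hgle, hlr₃, hnr₄, h2r₃, hr₄₃, hκr₁, hκr₂, hκr₃, hκr₄, hr₁r, hw⟩ := exists_radii (half := half) (Γ := Γ) hq1 hn0 hl0 hJ0
      (le_trans (Nat.mul_le_mul_left _ (by omega)) hN) hκ hκ14 hκN hθ hr
  have hr₁ : 0 < r₁ := by linarith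
  have hwr₁ : θ * r ≤ r₁ := by linarith
  have hwr₂ : θ * r ≤ r₂ := by linarith
  have hr₂r : r₂ ≤ r := by linarith
  have hW₁ne : (bohr Γ r₁).Nonempty := card_pos.1 (card_bohr_pos hr₁.le)
  have hW₂ne : (bohr Γ r₂).Nonempty := card_pos.1 (card_bohr_pos hr₂.le)
  obtain ⟨x, hx₁, hx₂⟩ := exists_dens_ge A hr.le (by positivity) hreg hW₁ne (bohr_mono hr₁u) hW₂ne
    (bohr_mono (by linarith)) (by linarith) hdens (H Γ (by omega) r₁ hwr₁ hr₁r hreg₁)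
    (H Γ (by omega) r₂ hwr₂ hr₂r hreg₂)
  have hB₁ : (0 : ℝ) < #(bohr Γ r₁) := by exact_mod_cast hW₁ne.card_pos
  have hB₂ : (0 : ℝ) < #(bohr Γ r₂) := by exact_mod_cast hW₂ne.card_pos
  set A₁ := localPart A (bohr Γ r₁) x with hA₁
  set A₂ := localPart A (bohr Γ r₂) x with hA₂
  have hc₁ : 98 / 100 * α * #(bohr Γ r₁) ≤ #A₁ := by
    rw [card_localPart A hW₁ne]; gcongr
  have hc₂ : 98 / 100 * α * #(bohr Γ r₂) ≤ #A₂ := by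
    rw [card_localPart A hW₂ne]; gcongr
  have hA₁0 : (0 : ℝ) < #A₁ := lt_of_lt_of_le (by positivity) hc₁
  have hA₂0 : (0 : ℝ) < #A₂ := lt_of_lt_of_le (by positivity) hc₂
  have hA₁ne : A₁.Nonempty := card_pos.1 (by exact_mod_cast hA₁0)
  have hA₁W : ∀ a ∈ A₁, a ∈ bohr Γ r₁ := fun a ha => (mem_filter.1 ha).1
  have hdsub : ∀ {s : ℝ} {z : G}, z ∈ bohr Γd s → z ∈ bohr Γ (2 * s) := fun hz =>
    bohr_dil_subset hh Γ _ hz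
  have hqinv : 1 / (q : ℝ) ≤ 1 / 20480 := one_div_le_one_div_of_le (by norm_num) hqbig
  have hBp : (#(bohr Γ (r₁ + κ * r₁)) : ℝ) ≤ (1 + 1 / 20480) * #(bohr Γ r₁) :=
    hreg₁.trans (by gcongr)
  have hcardX : ∀ s, #(bohr Γd s) = #(bohr Γ s) := card_bohr_dil hh Γ
  let E := A₂.image fun y => y + y
  have hinj : Function.Injective fun y : G => y + y := fun y z hyz => by
    have := congrArg half hyz
    simpa [half_add_self hh] using this
  have hEcard : #E = #A₂ := card_image_of_injective _ hinj
  have hfin : α / 2 ≤ (∑ z ∈ E, selfConv A₁ z) / #E := by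
    refine le_sum_of_chain (selfConv_nonneg A₁) (selfConv_le_one A₁)
      (X := fun j : ℕ => bohr Γd (r₂ + j * g)) hα hm hJ hp ?_ ?_ ?_ ?_ ?_
    · intro j hj
      have hj' : (j : ℝ) ≤ J := by exact_mod_cast hj
      have h1 : r₂ + j * g ≤ r₂ + κ * r₂ := by rw [← hgJ]; gcongr
      have h2 : (#(bohr Γ (r₂ + j * g)) : ℝ) ≤ #(bohr Γ (r₂ + κ * r₂)) := by
        exact_mod_cast card_le_card (bohr_mono h1)
      simp only [hcardX, Nat.cast_zero, zero_mul, add_zero]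
      exact (h2.trans hreg₂).trans (by gcongr; linarith)
    · intro j hj
      have hj' : ((j + 1 : ℕ) : ℝ) ≤ J := by exact_mod_cast hj
      have hjg : ((j + 1 : ℕ) : ℝ) * g ≤ κ * r₂ := by rw [← hgJ]; gcongr
      refine exists_approx (Bp := bohr Γ (r₁ + κ * r₁)) (r₃ := r₃) (r₄ := r₄) hA₁ne
        (by omega) hp hl hq hl1 hQ hk hn hκ ?_ hκN
        hr₃.le hr₄ ?_ (by positivity) ?_ ?_ hreg₃ hreg₄ hnr₄ ?_ ?_ ?_ ?_ ?_
      · exact le_trans (Nat.mul_le_mul_left _ (by omega)) hN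
      · rw [le_div_iff₀ (by positivity)]
        have h1 : r₃ ≤ 1 := by linarith
        calc κ * r₄ * (q * n) = (κ * q) * (n * r₄) := by ring
          _ ≤ 1 * (κ * r₃) := by gcongr; linarith
          _ ≤ 1 := by linarith
      · intro a ha s hs
        exact sub_mem_bohr (hA₁W a ha) (hdsub hs) (by linarith)
      · have h2 : (1 : ℝ) * #(bohr Γ r₁) ≤ (α * 2 ^ p) * #(bohr Γ r₁) := by gcongr
        have h3 : (2 : ℝ) ^ (p + 2) * (98 / 100 * α * #(bohr Γ r₁)) ≤ 2 ^ (p + 2) * #A₁ := by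
          gcongr
        rw [pow_add] at h3 ⊢
        linarith
      · push_cast; linarith
      · intro Γ' hΓ' w hw1 hw2 hwr z
        exact (dens_localPart_le _ _ _ _ _).trans
          (H Γ' (by omega) w (by linarith) (by linarith) hwr _)
      · intro a ha w hw
        exact add_mem_bohr (hA₁W a ha) (hdsub hw) (by linarith)
      · intro z hz a ha w hw
        rw [sub_add_eq_add_sub, add_sub_right_comm, ← neg_add_eq_sub]
        refine add_mem_bohr (add_mem_bohr (s := κ * r₁ / 2) (neg_mem_bohr (hA₁W a ha))
          (bohr_mono ?_ (hdsub hz)) le_rfl) (hdsub hw) ?_ <;> linarith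
      · have h1 : 101 / 100 * α * #(bohr Γ (r₁ + κ * r₁)) ≤
            101 / 100 * α * ((1 + 1 / 20480) * #(bohr Γ r₁)) := by gcongr
        have h2 : 0 ≤ α * #(bohr Γ r₁) := by positivity
        linarith
    · intro z hz
      obtain ⟨y, hy, rfl⟩ := mem_image.1 hz
      simp only [Nat.cast_zero, zero_mul, add_zero]
      rw [mem_bohr_dil, half_add_self hh]
      exact (mem_filter.1 hy).1
    · rw [← card_pos, hEcard]; exact_mod_cast hA₂0
    · simp only [hcardX, Nat.cast_zero, zero_mul, add_zero, hEcard]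
      have h2 : 0 ≤ α * #(bohr Γ r₂) := by positivity
      linarith
  have hle : (∑ z ∈ E, selfConv A₁ z) / #E ≤ 1 / #A₁ := by
    rw [hEcard, div_le_iff₀ hA₂0, mul_comm, ← hEcard, ← nsmul_eq_mul]
    refine sum_le_card_nsmul _ _ _ fun z hz => ?_
    obtain ⟨y, hy, rfl⟩ := mem_image.1 hz
    exact selfConv_localPart_le hfree _ _ x hy
  have hA₁le : α / 2 * #A₁ ≤ 1 := by
    have := hfin.trans hle
    rwa [le_div_iff₀ hA₁0] at this
  have hsub : (#(bohr Γ (κ * r / 2)) : ℝ) ≤ #(bohr Γ r₁) := by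
    exact_mod_cast card_le_card (bohr_mono hr₁l)
  refine hsub.trans ?_
  have h4 : α ^ 2 * #(bohr Γ r₁) ≤ 4 := by
    have := mul_le_mul_of_nonneg_left hc₁ hα.le
    linarith
  have h5 : (1 : ℝ) ≤ (α * 2 ^ p) ^ 2 := one_le_pow₀ hp
  have h6 : (4 : ℝ) ^ p = (2 ^ p) ^ 2 := by rw [← pow_mul, mul_comm, pow_mul]; norm_num
  calc (#(bohr Γ r₁) : ℝ) = 1 * #(bohr Γ r₁) := by ring
    _ ≤ (α * 2 ^ p) ^ 2 * #(bohr Γ r₁) := by gcongr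
    _ = (α ^ 2 * #(bohr Γ r₁)) * (2 ^ p) ^ 2 := by ring
    _ ≤ 4 * 4 ^ p := by rw [h6]; gcongr

end Step

section Iterate
variable {G : Type*} [AddCommGroup G] [Fintype G] [DecidableEq G]

lemma bohr_empty (r : ℝ) : bohr (∅ : Finset (AddChar G ℂ)) r = univ := by
  ext; simp [mem_bohr]

lemma dens_univ (A : Finset G) (x : G) : dens A univ x = #A / Fintype.card G := by
  rw [dens, ← sum_ind A, ← Equiv.sum_comp (Equiv.addLeft x) (ind A)]; rfl

lemma exists_small_bohr {half : G →+ G} (hh : ∀ x, half x + half x = x)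
    {A : Finset G} (hfree : ∀ a ∈ A, ∀ b ∈ A, ∀ c ∈ A, a + c = b + b → a = b)
    {p l m J k n q N I : ℕ} {α Q κ θ : ℝ}
    (hm : p + 1 ≤ m) (hJ : p + 1 ≤ J) (hp : 1 ≤ α * 2 ^ p) (hl : 2048 ≤ α * 4 ^ l)
    (hq : 20480 ≤ α * q) (hl1 : 1 ≤ l) (hQ : 16 * 192 * l ^ 2 * 1024 ^ 2 ≤ Q)
    (hk : Q * m * 2 ^ p ≤ k) (hn : 8 * (k * (p + 2) + 4) ≤ n) (hκ : 0 < κ)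
    (hN : 7 * q * (I * n + 1) ≤ N) (hκN : 2 * κ * N ≤ 1) (hθ0 : 0 < θ) (hθ1 : θ ≤ 1)
    (hθ : θ * (512 * n * l * J) ≤ κ ^ 5) (hα : α ≤ #A / Fintype.card G)
    (hI : 1 < α * (101 / 100) ^ I) :
    ∃ Γ : Finset (AddChar G ℂ), #Γ ≤ I * n ∧
      (#(bohr Γ (κ * θ ^ I)) : ℝ) ≤ 4 * 4 ^ p := by
  by_contra! hcon
  have hα0 : 0 < α := by
    have : (0 : ℝ) < 2 ^ p := by positivity
    nlinarith
  have key : ∀ i ≤ I, ∃ (Γ : Finset (AddChar G ℂ)) (r : ℝ) (x₀ : G), #Γ ≤ i * n ∧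
      2 * θ ^ i ≤ r ∧ r ≤ 2 ∧ IsRegular Γ κ q r ∧
      α * (101 / 100) ^ i ≤ dens A (bohr Γ r) x₀ := by
    intro i
    induction i with
    | zero =>
      intro _
      refine ⟨∅, 2, 0, by simp, by simp, le_rfl, ?_, ?_⟩
      · rw [IsRegular, bohr_empty, bohr_empty]
        refine le_mul_of_one_le_left (Nat.cast_nonneg _) ?_
        rw [le_add_iff_nonneg_right]; positivity
      · rw [bohr_empty, dens_univ, pow_zero, mul_one]; exact hα
    | succ i ih =>
      intro hi
      obtain ⟨Γ, r, x₀, hΓ, hrl, hru, hreg, hd⟩ := ih (by omega)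
      have hr0 : 0 < r := lt_of_lt_of_le (by positivity) hrl
      have hin : i * n + n ≤ I * n := by
        rw [← Nat.succ_mul]; exact Nat.mul_le_mul_right _ hi
      have hge : α ≤ α * (101 / 100) ^ i :=
        le_mul_of_one_le_right hα0.le (one_le_pow₀ (by norm_num))
      have hbig : (4 * 4 ^ p : ℝ) < #(bohr Γ (κ * r / 2)) := by
        refine (hcon Γ (by omega)).trans_le ?_
        have h1 : θ ^ I ≤ θ ^ i := pow_le_pow_of_le_one hθ0.le hθ1 (by omega)
        have h2 : κ * θ ^ I ≤ κ * (r / 2) := by gcongr; linarith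
        exact_mod_cast card_le_card (bohr_mono (by linarith))
      have hnot := mt (card_bohr_le_of_no_increment hh hfree hm hJ
        (hp.trans (by gcongr)) (hl.trans (by gcongr)) (hq.trans (by gcongr)) hl1 hQ hk hn hκ
        (le_trans (Nat.mul_le_mul_left _ (by omega)) hN) hκN hθ hr0 hru hreg hd) (not_le.2 hbig)
      push Not at hnot
      obtain ⟨Γ', hΓ', r', hr'l, hr'u, hreg', x, hx⟩ := hnot
      refine ⟨Γ', r', x, ?_, ?_, hr'u.trans hru, hreg', ?_⟩
      · rw [Nat.succ_mul]; omega
      · refine le_trans ?_ hr'l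
        calc 2 * θ ^ (i + 1) = θ * (2 * θ ^ i) := by ring
          _ ≤ θ * r := by gcongr
      · rw [pow_succ]; linarith
  obtain ⟨Γ, r, x₀, -, -, -, -, hd⟩ := key I le_rfl
  linarith [dens_le_one A (bohr Γ r) x₀]

lemma card_le_of_free {half : G →+ G} (hh : ∀ x, half x + half x = x)
    {A : Finset G} (hfree : ∀ a ∈ A, ∀ b ∈ A, ∀ c ∈ A, a + c = b + b → a = b)
    {p : ℕ} (hp : 1 ≤ (#A / Fintype.card G : ℝ) * 2 ^ p) :
    Fintype.card G ≤ 81 ^ (2 ^ 67 * (p + 1) ^ 7 * 2 ^ (p + 1)) := by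
  obtain ⟨P, hP⟩ : ∃ P, P = p + 1 := ⟨_, rfl⟩
  rw [← hP]
  have hP1 : 1 ≤ P := by omega
  set α : ℝ := #A / Fintype.card G with hα
  have hα0 : 0 < α := by
    have : (0 : ℝ) < 2 ^ p := by positivity
    nlinarith
  have hPP : P ≤ 2 ^ P := Nat.lt_two_pow_self.le
  have hpow : ∀ a b : ℕ, a ≤ b → 2 ^ a ≤ 2 ^ (b * P) := fun a b hab =>
    Nat.pow_le_pow_right (by norm_num) (hab.trans (Nat.le_mul_of_pos_right _ hP1))
  have hαp : ∀ a b : ℕ, p + a ≤ b → (2 : ℝ) ^ a ≤ α * 2 ^ b := by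
    intro a b hab
    calc (2 : ℝ) ^ a = 1 * 2 ^ a := by ring
      _ ≤ α * 2 ^ p * 2 ^ a := by gcongr
      _ = α * 2 ^ (p + a) := by ring
      _ ≤ α * 2 ^ b := by gcongr; norm_num
  obtain ⟨n, hn⟩ : ∃ n, n = 2 ^ 43 * P ^ 4 * 2 ^ P := ⟨_, rfl⟩
  have hnle : n ≤ 2 ^ (48 * P) := by
    calc n ≤ 2 ^ (43 * P) * (2 ^ P) ^ 4 * 2 ^ P := by
          rw [hn]; gcongr
          · norm_num
          · omega
      _ = 2 ^ (48 * P) := by ring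
  have hI : 100 * P ≤ 2 ^ (8 * P) := by
    calc 100 * P ≤ 2 ^ (7 * P) * 2 ^ P := Nat.mul_le_mul (by have := hpow 7 7 le_rfl; omega) hPP
      _ = 2 ^ (8 * P) := by ring
  have hN : 7 * 2 ^ (15 * P) * (100 * P * n + 1) ≤ 2 ^ (75 * P) := by
    have h1 : 100 * P * n + 1 ≤ 2 ^ (57 * P) := by
      have h2 := Nat.mul_le_mul hI hnle
      have h3 : 2 ^ (57 * P) = 2 ^ P * (2 ^ (8 * P) * 2 ^ (48 * P)) := by ring
      have h4 : 2 ≤ 2 ^ P := by simpa using hpow 1 1 le_rfl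
      have h5 : 1 ≤ 2 ^ (8 * P) * 2 ^ (48 * P) := Nat.one_le_iff_ne_zero.2 (by positivity)
      rw [h3]; nlinarith
    calc _ ≤ 2 ^ (3 * P) * 2 ^ (15 * P) * 2 ^ (57 * P) := by
          gcongr
          have := hpow 3 3 le_rfl; omega
      _ = 2 ^ (75 * P) := by ring
  have hθn : 512 * n * (6 * P) * P ≤ 2 ^ (62 * P) := by
    calc _ ≤ 2 ^ (9 * P) * 2 ^ (48 * P) * (2 ^ (3 * P) * 2 ^ P) * 2 ^ P := by
          gcongr
          · exact hpow 9 9 le_rfl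
          · have := hpow 3 3 le_rfl; omega
      _ = 2 ^ (62 * P) := by ring
  have hex : ∃ Γ : Finset (AddChar G ℂ), #Γ ≤ 100 * P * n ∧
      (#(bohr Γ (1 / 2 ^ (76 * P) * (1 / 2 ^ (442 * P)) ^ (100 * P))) : ℝ) ≤ 4 * 4 ^ p := by
    refine exists_small_bohr hh hfree (p := p) (l := 6 * P) (m := P) (J := P)
      (k := 2 ^ 38 * P ^ 3 * 2 ^ P) (n := n) (q := 2 ^ (15 * P)) (N := 2 ^ (75 * P)) (I := 100 * P)
      (α := α) (Q := 2 ^ 38 * P ^ 2) (κ := 1 / 2 ^ (76 * P)) (θ := 1 / 2 ^ (442 * P))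
      hP.ge hP.ge hp ?_ ?_ (by omega) ?_ ?_ ?_ (by positivity) hN ?_ (by positivity) ?_ ?_ le_rfl ?_
    · have h := hαp 11 (2 * (6 * P)) (by omega)
      rw [pow_mul] at h
      norm_num at h ⊢
      exact h
    · have h := hαp 15 (15 * P) (by omega)
      push_cast
      refine le_trans (by norm_num) h
    · push_cast
      have : (0 : ℝ) ≤ (P : ℝ) ^ 2 := by positivity
      nlinarith
    · simp only [Nat.cast_mul, Nat.cast_pow, Nat.cast_ofNat]
      have : (2 : ℝ) ^ p ≤ 2 ^ P := pow_le_pow_right₀ (by norm_num) (by omega)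
      calc _ = 2 ^ 38 * (P : ℝ) ^ 3 * 2 ^ p := by ring
        _ ≤ _ := mul_le_mul_of_nonneg_left this (by positivity)
    · have h1 : 1 ≤ P ^ 4 * 2 ^ P := Nat.one_le_iff_ne_zero.2 (by positivity)
      calc 8 * (2 ^ 38 * P ^ 3 * 2 ^ P * (p + 2) + 4) ≤
            8 * (2 ^ 38 * P ^ 3 * 2 ^ P * (2 * P) + 4 * (P ^ 4 * 2 ^ P)) := by
              gcongr
              · omega
              · omega
        _ = (2 ^ 42 + 32) * (P ^ 4 * 2 ^ P) := by ring
        _ ≤ 2 ^ 43 * (P ^ 4 * 2 ^ P) := by gcongr; norm_num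
        _ = n := by rw [hn]; ring
    · have h1 : (2 : ℝ) ^ (76 * P) = 2 ^ P * 2 ^ (75 * P) := by ring
      have h2 : (2 : ℝ) ≤ 2 ^ P := by exact_mod_cast (by simpa using hpow 1 1 le_rfl : 2 ≤ 2 ^ P)
      push_cast
      rw [h1]
      have h3 : (0 : ℝ) < 2 ^ (75 * P) := by positivity
      calc (2 : ℝ) * (1 / (2 ^ P * 2 ^ (75 * P))) * 2 ^ (75 * P) = 2 / 2 ^ P := by field_simp
        _ ≤ 1 := by rw [div_le_one (by positivity)]; exact h2
    · rw [div_le_one (by positivity)]; exact one_le_pow₀ (by norm_num)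
    · have h1 : (512 * n * (6 * P : ℕ) * P : ℝ) ≤ 2 ^ (62 * P) := by exact_mod_cast hθn
      calc _ ≤ (1 : ℝ) / 2 ^ (442 * P) * 2 ^ (62 * P) := by gcongr
        _ = _ := by
          rw [div_pow, one_pow, ← pow_mul, show 442 * P = 62 * P + 76 * P * 5 by ring, pow_add]
          field_simp
    · have h1 : (2 : ℝ) ≤ (101 / 100) ^ 100 := by
        norm_num
      have h2 : (2 : ℝ) ^ P ≤ (101 / 100) ^ (100 * P) := by
        rw [pow_mul]; gcongr
      have h3 := hαp 1 P (by omega)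
      have h4 : α * 2 ^ P ≤ α * (101 / 100) ^ (100 * P) := by gcongr
      linarith
  obtain ⟨Γ, hΓ, hsmall⟩ := hex
  have hrad : (1 : ℝ) / 2 ^ (76 * P) * (1 / 2 ^ (442 * P)) ^ (100 * P) =
      2 / 2 ^ (1 + 76 * P + 442 * P * (100 * P)) := by
    rw [pow_add, pow_add, pow_mul 2 (442 * P), div_pow, one_pow]
    field_simp
  rw [hrad] at hsmall
  have hs : #(bohr Γ (2 / 2 ^ (1 + 76 * P + 442 * P * (100 * P)))) ≤ 4 * 4 ^ p := by
    exact_mod_cast hsmall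
  refine (card_le_card_bohr Γ (1 + 76 * P + 442 * P * (100 * P))).trans ?_
  have hx : (1 + 76 * P + 442 * P * (100 * P)) * #Γ + P ≤ 2 ^ 67 * P ^ 7 * 2 ^ P := by
    have h1 : 1 + 76 * P + 442 * P * (100 * P) ≤ 2 ^ 16 * P ^ 2 := by nlinarith
    have h2 : P ≤ P ^ 7 * 2 ^ P :=
      le_trans (Nat.le_self_pow (by norm_num) P) (Nat.le_mul_of_pos_right _ (by positivity))
    calc _ ≤ 2 ^ 16 * P ^ 2 * (100 * P * n) + P ^ 7 * 2 ^ P :=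
          Nat.add_le_add (Nat.mul_le_mul h1 hΓ) h2
      _ = (2 ^ 16 * 100 * 2 ^ 43 + 1) * (P ^ 7 * 2 ^ P) := by rw [hn]; ring
      _ ≤ 2 ^ 67 * (P ^ 7 * 2 ^ P) := by gcongr; norm_num
      _ = _ := by ring
  calc _ ≤ 81 ^ ((1 + 76 * P + 442 * P * (100 * P)) * #Γ) * (4 * 4 ^ p) :=
        Nat.mul_le_mul_left _ hs
    _ = 81 ^ ((1 + 76 * P + 442 * P * (100 * P)) * #Γ) * 4 ^ P := by rw [hP, pow_succ 4 p]; ring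
    _ ≤ 81 ^ ((1 + 76 * P + 442 * P * (100 * P)) * #Γ) * 81 ^ P := by gcongr; norm_num
    _ = 81 ^ ((1 + 76 * P + 442 * P * (100 * P)) * #Γ + P) := (pow_add _ _ _).symm
    _ ≤ _ := Nat.pow_le_pow_right (by norm_num) hx

end Iterate

section Integers

lemma two_mul_add_one_le_of_free {N : ℕ} {A : Finset ℕ} (hA : A ⊆ Finset.Icc 1 N)
    (hfree : ∀ x d : ℕ, x ∈ A → x + d ∈ A → x + 2 * d ∈ A → d = 0) {p : ℕ}
    (hp : 1 ≤ (#A / (2 * N + 1 : ℕ) : ℝ) * 2 ^ p) :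
    2 * N + 1 ≤ 81 ^ (2 ^ 67 * (p + 1) ^ 7 * 2 ^ (p + 1)) := by
  have hcast : ∀ a b : ℕ, a ≤ 2 * N → b ≤ 2 * N → (a : ZMod (2 * N + 1)) = b → a = b := by
    intro a b ha hb hab
    rw [ZMod.natCast_eq_natCast_iff', Nat.mod_eq_of_lt (by omega),
      Nat.mod_eq_of_lt (by omega)] at hab
    exact hab
  have hle : ∀ a ∈ A, a ≤ N := fun a ha => (mem_Icc.1 (hA ha)).2
  have hcard : #(A.image fun a : ℕ => (a : ZMod (2 * N + 1))) = #A := by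
    refine card_image_of_injOn fun a ha b hb hab => hcast a b ?_ ?_ hab
    · have := hle a ha; omega
    · have := hle b hb; omega
  have hh : ∀ x : ZMod (2 * N + 1),
      AddMonoidHom.mulLeft ((N + 1 : ℕ) : ZMod (2 * N + 1)) x +
        AddMonoidHom.mulLeft ((N + 1 : ℕ) : ZMod (2 * N + 1)) x = x := by
    intro x
    rw [AddMonoidHom.coe_mulLeft, ← add_mul, ← Nat.cast_add,
      show N + 1 + (N + 1) = 2 * N + 1 + 1 by ring, Nat.cast_succ, ZMod.natCast_self, zero_add,
      one_mul]
  have key := card_le_of_free hh (A := A.image fun a : ℕ => (a : ZMod (2 * N + 1))) (p := p) ?_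
    (by rwa [hcard, ZMod.card])
  · rwa [ZMod.card] at key
  · intro _ ha' _ hb' _ hc' h
    obtain ⟨a, ha, rfl⟩ := mem_image.1 ha'
    obtain ⟨b, hb, rfl⟩ := mem_image.1 hb'
    obtain ⟨c, hc, rfl⟩ := mem_image.1 hc'
    have haN := hle a ha
    have hbN := hle b hb
    have hcN := hle c hc
    have habc : a + c = b + b := hcast _ _ (by omega) (by omega) (by push_cast; exact h)
    rcases le_total a b with hab | hab
    · have := hfree a (b - a) ha (by rwa [Nat.add_sub_cancel' hab])
        (by rwa [show a + 2 * (b - a) = c by omega])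
      rw [show a = b by omega]
    · have := hfree c (b - c) hc (by rwa [show c + (b - c) = b by omega])
        (by rwa [show c + 2 * (b - c) = a by omega])
      rw [show a = b by omega]

lemma exists_pow_le_mul_two_pow : ∃ K : ℝ, 0 < K ∧ ∀ p : ℕ, ((p : ℝ) + 1) ^ 21 ≤ K * 2 ^ p := by
  obtain ⟨K, hK⟩ := (tendsto_pow_const_div_const_pow_of_one_lt 21
    (show (1 : ℝ) < 2 by norm_num)).bddAbove_range
  have h : ∀ n : ℕ, (n : ℝ) ^ 21 ≤ K * 2 ^ n := fun n => by
    have := hK ⟨n, rfl⟩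
    rwa [div_le_iff₀ (by positivity)] at this
  have hK0 : 0 < K := by
    have := h 1
    norm_num at this
    linarith
  refine ⟨K * 2, by positivity, fun p => ?_⟩
  have := h (p + 1)
  push_cast at this
  rw [pow_succ 2 p] at this
  linarith

lemma exists_card_mul_log_le : ∃ K : ℝ, 0 < K ∧ ∀ N : ℕ, 2 ≤ N → ∀ A : Finset ℕ,
    A ⊆ Finset.Icc 1 N → (∀ x d : ℕ, x ∈ A → x + d ∈ A → x + 2 * d ∈ A → d = 0) →
    (#A : ℝ) * Real.log N ^ ((3 : ℝ) / 4) ≤ K * N := by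
  obtain ⟨K, hK, hKp⟩ := exists_pow_le_mul_two_pow
  obtain ⟨M, hM, hM0⟩ : ∃ M : ℝ, M = 2 ^ 67 * 2 * Real.log 81 ∧ 0 < M :=
    ⟨_, rfl, by have := Real.log_pos (show (1 : ℝ) < 81 by norm_num); positivity⟩
  refine ⟨3 * (1 + 16 * (M ^ 3 * K)), by positivity, fun N hN A hA hfree => ?_⟩
  rcases A.eq_empty_or_nonempty with rfl | hne
  · simp; positivity
  have hN' : (2 : ℝ) ≤ N := by exact_mod_cast hN
  have hA0 : (0 : ℝ) < #A := by exact_mod_cast hne.card_pos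
  have hAN : (#A : ℝ) ≤ N := by
    have := card_le_card hA
    rw [Nat.card_Icc] at this
    exact_mod_cast (by omega : #A ≤ N)
  set L := Real.log N with hL
  have hL0 : 0 < L := Real.log_pos (by linarith)
  obtain ⟨δ, hδ⟩ : ∃ δ : ℝ, δ = #A / (2 * N + 1 : ℕ) := ⟨_, rfl⟩
  have hN1 : (0 : ℝ) < (2 * N + 1 : ℕ) := by positivity
  have hδ0 : 0 < δ := by rw [hδ]; positivity
  have hδ1 : δ ≤ 1 := by
    rw [hδ, div_le_one hN1]; push_cast; linarith
  obtain ⟨t, ht1, ht2⟩ := exists_nat_pow_near (one_le_one_div hδ0 hδ1) (show (1 : ℝ) < 2 by norm_num)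
  rw [le_div_iff₀ hδ0] at ht1
  rw [div_lt_iff₀ hδ0] at ht2
  have hp := two_mul_add_one_le_of_free hA hfree (p := t + 1) (by rw [← hδ]; linarith)
  obtain ⟨p, hpt⟩ : ∃ p, p = t + 1 := ⟨_, rfl⟩
  rw [← hpt] at hp
  have hpδ : 2 ^ p * δ ≤ 2 := by rw [hpt, pow_succ]; linarith
  have hlog : L ≤ M * ((p + 1) ^ 7 * 2 ^ p) := by
    have h1 : (N : ℝ) ≤ 81 ^ (2 ^ 67 * (p + 1) ^ 7 * 2 ^ (p + 1)) := by
      exact_mod_cast (by omega : N ≤ 2 * N + 1).trans hp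
    have h2 := Real.log_le_log (by linarith) h1
    rw [Real.log_pow] at h2
    refine h2.trans (le_of_eq ?_)
    rw [hM]
    simp only [Nat.cast_mul, Nat.cast_pow, Nat.cast_ofNat, Nat.cast_add, Nat.cast_one]
    ring
  have hδL : (δ * L ^ ((3 : ℝ) / 4)) ^ 4 ≤ 16 * (M ^ 3 * K) := by
    have h1 : (L ^ ((3 : ℝ) / 4)) ^ 4 = L ^ 3 := by
      rw [← Real.rpow_natCast, ← Real.rpow_mul hL0.le, ← Real.rpow_natCast]
      norm_num
    have h2 : L ^ 3 ≤ (M * ((p + 1) ^ 7 * 2 ^ p)) ^ 3 := pow_le_pow_left₀ hL0.le hlog 3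
    have h3 : (M * (((p : ℝ) + 1) ^ 7 * 2 ^ p)) ^ 3 ≤ M ^ 3 * (K * 2 ^ p) * (2 ^ p) ^ 3 := by
      calc _ = M ^ 3 * ((p : ℝ) + 1) ^ 21 * (2 ^ p) ^ 3 := by ring
        _ ≤ _ := by gcongr; exact hKp p
    rw [mul_pow, h1]
    calc δ ^ 4 * L ^ 3 ≤ δ ^ 4 * (M ^ 3 * (K * 2 ^ p) * (2 ^ p) ^ 3) := by gcongr; exact h2.trans h3
      _ = (2 ^ p * δ) ^ 4 * (M ^ 3 * K) := by ring
      _ ≤ 2 ^ 4 * (M ^ 3 * K) := by gcongr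
      _ = _ := by norm_num
  have hfin : δ * L ^ ((3 : ℝ) / 4) ≤ 1 + 16 * (M ^ 3 * K) := by
    have h1 : (1 : ℝ) ≤ 1 + 16 * (M ^ 3 * K) := by
      rw [le_add_iff_nonneg_right]; positivity
    refine le_of_pow_le_pow_left₀ (n := 4) (by norm_num) (by linarith) (hδL.trans ?_)
    exact le_trans (by linarith) (le_self_pow₀ h1 (by norm_num))
  have hAδ : (#A : ℝ) = δ * (2 * N + 1 : ℕ) := by rw [hδ]; field_simp
  have h2N : ((2 * N + 1 : ℕ) : ℝ) ≤ 3 * N := by push_cast; linarith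
  calc (#A : ℝ) * L ^ ((3 : ℝ) / 4) = (δ * L ^ ((3 : ℝ) / 4)) * (2 * N + 1 : ℕ) := by
        rw [hAδ]; ring
    _ ≤ (1 + 16 * (M ^ 3 * K)) * (3 * N) := by gcongr
    _ = _ := by ring

end Integers

end RothBohr

/-- **Roth's theorem with Sanders' bound.**  For every `ε > 0` there is a constant
`C(ε) > 0` such that for every `N ≥ 2`, if `A ⊆ {1,…,N}` contains no non-trivial
three-term arithmetic progression, then `|A| ≤ C(ε) · N / (log N)^(3/4 - ε)`. -/
theorem roth_sanders :
    ∀ ε : ℝ, 0 < ε → ∃ C : ℝ, 0 < C ∧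
      ∀ N : ℕ, 2 ≤ N → ∀ A : Finset ℕ, A ⊆ Finset.Icc 1 N →
        (∀ x d : ℕ, x ∈ A → x + d ∈ A → x + 2 * d ∈ A → d = 0) →
        (A.card : ℝ) ≤ C * N / Real.log N ^ ((3 : ℝ) / 4 - ε) := by
  intro ε hε
  obtain ⟨K, hK, hmain⟩ := RothBohr.exists_card_mul_log_le
  have hlog2 : 0 < Real.log 2 := Real.log_pos (by norm_num)
  refine ⟨K * Real.log 2 ^ (-ε), by positivity, fun N hN A hA hfree => ?_⟩
  have hN' : (2 : ℝ) ≤ N := by exact_mod_cast hN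
  have hL : Real.log 2 ≤ Real.log N := Real.log_le_log (by norm_num) hN'
  have hL0 : 0 < Real.log N := hlog2.trans_le hL
  rw [le_div_iff₀ (by positivity), sub_eq_add_neg, Real.rpow_add hL0, ← mul_assoc]
  calc _ ≤ K * N * Real.log 2 ^ (-ε) :=
        mul_le_mul (hmain N hN A hA hfree)
          (Real.rpow_le_rpow_of_nonpos hlog2 hL (by linarith)) (by positivity) (by positivity)
    _ = _ := by ring
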